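/- arXiv:1704.03592 — 2 statements merged into one kernel-verified Lean document; each statement's English description precedes it below -/
import Mathlib

section
/- 14 ≤ R(K_4^-, K_5; 3) ≤ 16. That is: (i) there exists a coloring of the 3-element subsets of a 13-element set with 2 colors such that no 4 vertices have at least 3 of their four 3-element subsets in color 1, and no 5 vertices have all ten of their 3-element subsets in color 2; and (ii) for every 2-coloring of the 3-element subsets of a 16-element set, either there are 4 vertices at least 3 of whose four 3-element subsets have color 1, or there are 5 vertices all ten of whose 3-element subsets have color 2. -/
/-- The coloring `c` of the 3-element subsets of `Fin n` contains a copy of the 3-uniform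
hypergraph `K₄⁻` in color `i`: a set of 4 vertices at least 3 of whose four 3-element subsets
have color `i`. -/
def HasK4minus {n k : ℕ} (c : Finset (Fin n) → Fin k) (i : Fin k) : Prop :=
  ∃ S : Finset (Fin n), S.card = 4 ∧
    3 ≤ ((S.powersetCard 3).filter fun t => c t = i).card

/-- The coloring `c` of the 3-element subsets of `Fin n` contains a copy of the complete
3-uniform hypergraph `K₅` in color `i`: a set of 5 vertices all ten of whose 3-element subsets
have color `i`. -/
def HasK5 {n k : ℕ} (c : Finset (Fin n) → Fin k) (i : Fin k) : Prop :=
  ∃ S : Finset (Fin n), S.card = 5 ∧ ∀ t ∈ S.powersetCard 3, c t = i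

/-- A binary decision tree with weights in `ℤ³` at its leaves. -/
inductive WeightTree
  | leaf (x y z : ℤ)
  | node (l r : WeightTree)

namespace WeightTree

/-- Descend to the right subtree if the flag is set, to the left one otherwise. -/
def branch (b : Bool) : WeightTree → WeightTree
  | leaf x y z => leaf x y z
  | node l r => bif b then r else l

/-- The weight at a leaf. -/
def value : WeightTree → ℤ × ℤ × ℤ
  | leaf x y z => (x, y, z)
  | node _ _ => (0, 0, 0)

/-- The leaf of weight zero. -/
def o : WeightTree := leaf 0 0 0

/-- Weights of vertex links over four vertices `a, b, c, d` spanning no edge. -/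
def emptyTree : WeightTree :=
  node (node (node (node (node (node o (leaf (-46) 4 0)) (node (leaf (-46) 4 0) (leaf (-24) 10
    0))) (node (node (leaf (-46) 4 0) (leaf (-24) 10 0)) (node (leaf (-24) 10 0) o))) (node (node
    (node (leaf 31 (-6) 0) (leaf (-8) 7 0)) (node (leaf (-8) 7 0) (leaf (-56) (-8) 0))) (node
    (node (leaf 5 1 0) (leaf 27 24 0)) (node (leaf 27 24 0) o)))) (node (node (node (node (leaf
    31 (-6) 0) (leaf (-8) 7 0)) (node (leaf 5 1 0) (leaf 27 24 0))) (node (node (leaf (-8) 7 0)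
    (leaf (-56) (-8) 0)) (node (leaf 27 24 0) o))) (node (node (node (leaf 73 (-18) 0) o) (node
    (leaf 4 (-19) 0) o)) (node (node (leaf 4 (-19) 0) o) (node (leaf 33 6 0) o))))) (node (node
    (node (node (node (leaf 31 (-6) 0) (leaf 5 1 0)) (node (leaf (-8) 7 0) (leaf 27 24 0))) (node
    (node (leaf (-8) 7 0) (leaf 27 24 0)) (node (leaf (-56) (-8) 0) o))) (node (node (node (leaf
    73 (-18) 0) (leaf 4 (-19) 0)) o) (node (node (leaf 4 (-19) 0) (leaf 33 6 0)) o))) (node (node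
    (node (node (leaf 73 (-18) 0) (leaf 4 (-19) 0)) (node (leaf 4 (-19) 0) (leaf 33 6 0))) o)
    (node (node (node (leaf 83 9 0) o) o) o)))

/-- Weights of vertex links over four vertices `a, b, c, d` spanning only the edge `abc`. -/
def edgeTree : WeightTree :=
  node (node (node (node (node (node (leaf (-25) (-81) 0) (leaf (-4) (-3) 0)) (node (leaf 4 4 0)
    (leaf 36 32 0))) (node (node (leaf (-78) (-58) 0) (leaf (-19) (-137) 0)) (node (leaf (-88) 93
    0) o))) (node (node (node (leaf 4 4 0) (leaf 36 32 0)) (node (leaf (-10) 110 0) (leaf 22 65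
    0))) (node (node (leaf (-49) 71 0) (leaf (-39) 71 0)) (node (leaf (-83) 88 0) o)))) (node
    (node (node (node (leaf (-78) (-58) 0) (leaf (-19) (-137) 0)) (node (leaf (-49) 71 0) (leaf
    (-39) 71 0))) o) (node (node (node (leaf (-88) 93 0) o) (node (leaf (-83) 88 0) o)) o)))
    (node (node (node (node (node (leaf 121 10 0) (leaf 140 11 0)) (node (leaf 111 62 0) (leaf
    175 8 0))) o) (node (node (node (leaf 111 62 0) (leaf 175 8 0)) o) o)) o)

/-- Weights of vertex links over four vertices `a, b, c, d` spanning only `abc` and `abd`. -/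
def pairTree : WeightTree :=
  node (node (node (node (node (node (leaf 23 0 74) (leaf (-63) 0 (-47))) (node (leaf (-3) (-73)
    36) (leaf (-69) (-47) (-42)))) (node (node (leaf (-3) (-73) 36) (leaf (-69) (-47) (-42)))
    (node (leaf 14 (-107) 23) o))) (node (node (node (leaf (-3) 73 36) (leaf (-69) 47 (-42))) o)
    (node (node (leaf (-72) 0 25) (leaf (-26) 0 4)) o))) (node (node (node (node (leaf (-3) 73
    36) (leaf (-69) 47 (-42))) (node (leaf (-72) 0 25) (leaf (-26) 0 4))) o) (node (node (node
    (leaf 14 107 23) o) o) o))) (node (node (node (node (node (leaf 211 0 (-61)) (leaf (-146) 0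
    (-27))) o) o) o) o)

end WeightTree

/-- The decision tree for the links over `(a, b, c, d)`. -/
def typeTree {α : Type*} (E : α → α → α → Bool) (a b c d : α) : WeightTree :=
  bif E a c d then .o else bif E b c d then .o else
    bif E a b c then (bif E a b d then .pairTree else .edgeTree) else
      bif E a b d then .o else .emptyTree

/-- The subtree reached by the link of `v` over `(a, b, c, d)`. -/
def linkTree {α : Type*} (E : α → α → α → Bool) (a b c d v : α) : WeightTree :=
  ((((((typeTree E a b c d).branch (E a b v)).branch (E a c v)).branch (E a d v)).branch
    (E b c v)).branch (E b d v)).branch (E c d v)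

/-- The weight attached to a vertex `v` over the quadruple `(a, b, c, d)`. -/
def linkWeight {α : Type*} (E : α → α → α → Bool) (a b c d v : α) : ℤ × ℤ × ℤ :=
  (linkTree E a b c d v).value

/-- The standard inner product on `ℤ³`. -/
def dot (p q : ℤ × ℤ × ℤ) : ℤ := p.1 * q.1 + (p.2.1 * q.2.1 + p.2.2 * q.2.2)

/-- The link of `u` contains `ab` or `ac`, but not `bc`. -/
def starLink {α : Type*} (E : α → α → α → Bool) (a b c u : α) : Bool :=
  (E a b u || E a c u) && !E b c u

/-- The summand of the two integrality cuts at the non-edge `abc`. -/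
def cut {α : Type*} (E : α → α → α → Bool) (a b c d v : α) : ℤ :=
  bif E a b c then 0 else
    (bif starLink E a b c d then (bif starLink E a b c v then 54396 else -63462) else 15110) +
    (bif E a b d then (bif E a b v then 61515 else -45111) else 8202)

/-- The local density function on ordered 6-tuples of vertices. -/
def density {α : Type*} (E : α → α → α → Bool) : List α → ℤ
  | [a, b, c, d, v, w] =>
    11 * dot (linkWeight E a b c d v) (linkWeight E a b c d w) +
      (dot (linkWeight E a b c d v) (linkWeight E a b c d v) + cut E a b c d v)
  | _ => 0

/-- Continue with the weight at a leaf. -/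
def WeightTree.withValue (k : ℤ → ℤ → ℤ → ℤ) : WeightTree → ℤ
  | .leaf x y z => k x y z
  | .node _ _ => k 0 0 0

/-- The quadratic form `22⟨p, q⟩ + |p|² + |q|²` in coordinates. -/
def pairForm (x y z x' y' z' : ℤ) : ℤ :=
  22 * dot (x, y, z) (x', y', z') + (dot (x, y, z) (x, y, z) + dot (x', y', z') (x', y', z'))

/-- The contribution to `density` of the pair `{v, w}` over the quadruple `(a, b, c, d)`. -/
def pairDensity {α : Type*} (E : α → α → α → Bool) (a b c d v w : α) : ℤ :=
  (linkTree E a b c d v).withValue fun x y z =>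
    (linkTree E a b c d w).withValue fun x' y' z' => pairForm x y z x' y' z'

/-- Choose among four integers by the number of true arguments. -/
def byCount (p q r s : ℤ) : Bool → Bool → Bool → ℤ
  | false, false, false => p
  | true, false, false => q
  | false, true, false => q
  | false, false, true => q
  | true, true, false => r
  | true, false, true => r
  | false, true, true => r
  | true, true, true => s

/-- The sum of `density` over the orderings of a 6-set that start with `(a, b, c)`, where
`x, y, z` are the other three vertices. -/
def tripleDensity {α : Type*} (E : α → α → α → Bool) (a b c x y z : α) : ℤ :=
  pairDensity E a b c x y z + (pairDensity E a b c y x z + (pairDensity E a b c z x y +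
    bif E a b c then 0 else
      (byCount 90660 (-66484) 12088 326376
        (starLink E a b c x) (starLink E a b c y) (starLink E a b c z) +
       byCount 49212 (-57414) 49212 369090 (E a b x) (E a b y) (E a b z))))

/-- Sum of `F` over the four ways to move one of the arguments to the front. -/
def pickFour {α : Type*} (F : α → α → α → α → ℤ) (a b c d : α) : ℤ :=
  F a b c d + (F b a c d + (F c a b d + F d a b c))

/-- Sum of `F` over the five ways to move one of the arguments to the front. -/
def pickFive {α : Type*} (F : α → α → α → α → α → ℤ) (a b c d e : α) : ℤ :=
  F a b c d e + (F b a c d e + (F c a b d e + (F d a b c e + F e a b c d)))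

/-- Sum of `F` over the six ways to move one of the arguments to the front. -/
def pickSix {α : Type*} (F : α → α → α → α → α → α → ℤ) (a b c d e f : α) : ℤ :=
  F a b c d e f + (F b a c d e f + (F c a b d e f +
    (F d a b c e f + (F e a b c d f + F f a b c d e))))

/-- The sum of `density` over the orderings of a 6-set. -/
def totalDensity {α : Type*} (E : α → α → α → Bool) : α → α → α → α → α → α → ℤ :=
  pickSix fun a => pickFive fun b => pickFour (tripleDensity E a b)

/-- The six vertex names, distinct powers of two. -/
def names : List ℕ := [1, 2, 4, 8, 16, 32]

/-- The triples of the first five names. -/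
def innerTriples : List (ℕ × ℕ × ℕ) :=
  [(1, 2, 4), (1, 2, 8), (1, 4, 8), (2, 4, 8), (1, 2, 16), (1, 4, 16), (2, 4, 16), (1, 8, 16),
   (2, 8, 16), (4, 8, 16)]

/-- The triples of names that contain `32`. -/
def outerTriples : List (ℕ × ℕ × ℕ) :=
  [(1, 2, 32), (1, 4, 32), (2, 4, 32), (1, 8, 32), (2, 8, 32), (4, 8, 32), (1, 16, 32),
   (2, 16, 32), (4, 16, 32), (8, 16, 32)]

/-- All triples of names. -/
def allTriples : List (ℕ × ℕ × ℕ) := innerTriples ++ outerTriples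

/-- The bit of a triple in a mask. -/
def tripleBit (t : ℕ × ℕ × ℕ) : ℕ := Nat.shiftLeft 1 (63 - (t.1 + t.2.1 + t.2.2))

/-- The bit of the triple `abc` is set in the mask `m`. -/
def maskEdge (m a b c : ℕ) : Bool :=
  Nat.beq (Nat.land 1 (Nat.shiftRight m (Nat.sub 63 (Nat.add a (Nat.add b c))))) 1

/-- Add to `m` the bits of the triples satisfying `p`. -/
def addMask (p : ℕ → ℕ → ℕ → Bool) : List (ℕ × ℕ × ℕ) → ℕ → ℕ
  | [], m => m
  | t :: ts, m => addMask p ts (bif p t.1 t.2.1 t.2.2 then Nat.lor m (tripleBit t) else m)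

/-- The image of the name `a` under the map of names given by its list of values. -/
def applyPerm (l : List ℕ) (a : ℕ) : ℕ := l.getD (Nat.log2 a) 0

/-- Permutations of the names fixing `32` that witness non-maximality of masks. -/
def innerPerms : List (List ℕ) :=
  [[8, 1, 2, 4, 16, 32],
   [2, 4, 1, 16, 8, 32],
   [4, 1, 2, 8, 16, 32],
   [1, 2, 8, 4, 16, 32],
   [1, 8, 16, 2, 4, 32],
   [1, 4, 2, 16, 8, 32]]

/-- Permutations of the names that witness non-maximality of masks. -/
def outerPerms : List (List ℕ) :=
  [[2, 1, 4, 8, 32, 16],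
   [2, 1, 8, 4, 16, 32],
   [1, 4, 2, 16, 8, 32],
   [1, 2, 4, 16, 8, 32],
   [1, 2, 8, 4, 16, 32],
   [4, 1, 2, 16, 32, 8],
   [8, 1, 32, 2, 4, 16],
   [16, 32, 4, 1, 8, 2],
   [2, 1, 4, 8, 16, 32],
   [2, 1, 8, 4, 32, 16],
   [1, 8, 16, 4, 2, 32],
   [8, 16, 2, 4, 1, 32],
   [1, 2, 8, 4, 32, 16],
   [4, 1, 16, 2, 32, 8],
   [16, 32, 1, 2, 4, 8],
   [2, 4, 1, 32, 8, 16],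
   [16, 32, 1, 8, 4, 2],
   [16, 4, 32, 1, 8, 2]]

/-- The mask of the structure `m` relabelled by a permutation. -/
def permMask (ts : List (ℕ × ℕ × ℕ)) (m : ℕ) (l : List ℕ) : ℕ :=
  addMask (fun a b c => maskEdge m (applyPerm l a) (applyPerm l b) (applyPerm l c)) ts 0

/-- Adding the triple `t` to `m` completes three edges on four vertices. -/
def blocked (m : ℕ) (t : ℕ × ℕ × ℕ) : Bool :=
  names.any fun d =>
    !(Nat.beq d t.1 || Nat.beq d t.2.1 || Nat.beq d t.2.2) &&
    ((maskEdge m t.1 t.2.1 d && (maskEdge m t.1 t.2.2 d || maskEdge m t.2.1 t.2.2 d)) ||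
      (maskEdge m t.1 t.2.2 d && maskEdge m t.2.1 t.2.2 d))

/-- Continue with the value of a natural number; the recursor makes evaluation eager. -/
def force (m : ℕ) (k : ℕ → Bool) : Bool := Nat.casesOn m (k 0) fun i => k (Nat.succ i)

/-- Check `k` on all extensions of `m` by triples of the list that avoid `blocked`. -/
def extendAll (k : ℕ → Bool) : List (ℕ × ℕ × ℕ) → ℕ → Bool
  | [], m => force m k
  | t :: ts, m => extendAll k ts m && (blocked m t || extendAll k ts (Nat.lor m (tripleBit t)))

/-- No triple of `ts` avoiding the name `d` is an edge of `m`. -/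
def emptyFive (ts : List (ℕ × ℕ × ℕ)) (m : ℕ) (d : ℕ) : Bool :=
  ts.all fun t =>
    Nat.beq d t.1 || Nat.beq d t.2.1 || Nat.beq d t.2.2 || !maskEdge m t.1 t.2.1 t.2.2

/-- The mask `m` has five names without edges, or is not maximal, or has negative density. -/
def leafCheck (m : ℕ) : Bool :=
  (names.any fun d => emptyFive allTriples m d) ||
  (outerPerms.any fun l => Nat.ble (Nat.succ m) (permMask allTriples m l)) ||
  decide (totalDensity (maskEdge m) 1 2 4 8 16 32 < 0)

/-- The mask `m` on the first five names has no edges, or is not maximal, or all its extensions to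
six names satisfy `leafCheck`. -/
def innerCheck (m : ℕ) : Bool :=
  emptyFive innerTriples m 32 ||
  (innerPerms.any fun l => Nat.ble (m + 4294967296) (permMask innerTriples m l)) ||
  extendAll leafCheck outerTriples m

section TupleSum

variable {α β : Type*} [DecidableEq α] [DecidableEq β]

/-- Sum of `F` over the ordered `k`-tuples of distinct elements of a finset. -/
def tupleSum : ℕ → Finset α → (List α → ℤ) → ℤ
  | 0, _, F => F []
  | k + 1, S, F => ∑ a ∈ S, tupleSum k (S.erase a) fun t => F (a :: t)

theorem sum_powersetCard_succ_sum_erase (k : ℕ) (U : Finset α) (g : α → Finset α → ℤ) :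
    ∑ S ∈ U.powersetCard (k + 1), ∑ a ∈ S, g a (S.erase a) =
      ∑ a ∈ U, ∑ T ∈ (U.erase a).powersetCard k, g a T := by
  rw [Finset.sum_sigma', Finset.sum_sigma']
  refine Finset.sum_bij' (fun x _ => ⟨x.2, x.1.erase x.2⟩) (fun y _ => ⟨insert y.1 y.2, y.1⟩)
    ?_ ?_ ?_ ?_ ?_
  · rintro ⟨S, a⟩ h
    simp only [Finset.mem_sigma, Finset.mem_powersetCard] at h ⊢
    exact ⟨h.1.1 h.2, Finset.erase_subset_erase _ h.1.1, by
      rw [Finset.card_erase_of_mem h.2, h.1.2, Nat.add_sub_cancel]⟩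
  · rintro ⟨a, T⟩ h
    simp only [Finset.mem_sigma, Finset.mem_powersetCard, Finset.subset_erase] at h ⊢
    exact ⟨⟨Finset.insert_subset h.1 h.2.1.1, by
      rw [Finset.card_insert_of_notMem h.2.1.2, h.2.2]⟩, Finset.mem_insert_self _ _⟩
  · rintro ⟨S, a⟩ h
    simp only [Finset.mem_sigma] at h
    simp [Finset.insert_erase h.2]
  · rintro ⟨a, T⟩ h
    simp only [Finset.mem_sigma, Finset.mem_powersetCard, Finset.subset_erase] at h
    simp [Finset.erase_insert h.2.1.2]
  · rintro ⟨S, a⟩ _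
    rfl

theorem sum_powersetCard_tupleSum (k : ℕ) (U : Finset α) (F : List α → ℤ) :
    ∑ S ∈ U.powersetCard k, tupleSum k S F = tupleSum k U F := by
  induction k generalizing U F with
  | zero => simp [tupleSum]
  | succ k ih =>
    simp only [tupleSum]
    rw [sum_powersetCard_succ_sum_erase k U fun a T => tupleSum k T fun t => F (a :: t)]
    simp only [ih]

theorem tupleSum_image (k : ℕ) (S : Finset α) (x : α → β) (hx : Set.InjOn x S)
    (F : List β → ℤ) : tupleSum k (S.image x) F = tupleSum k S fun t => F (t.map x) := by
  induction k generalizing S F with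
  | zero => rfl
  | succ k ih =>
    simp only [tupleSum, List.map_cons]
    rw [Finset.sum_image hx]
    refine Finset.sum_congr rfl fun a ha => ?_
    have h : (S.image x).erase (x a) = (S.erase a).image x := by
      ext b
      simp only [Finset.mem_erase, Finset.mem_image]
      constructor
      · rintro ⟨hb, c, hc, rfl⟩
        exact ⟨c, ⟨fun h => hb (h ▸ rfl), hc⟩, rfl⟩
      · rintro ⟨c, ⟨hca, hc⟩, rfl⟩
        exact ⟨fun h => hca (hx hc ha h), c, hc, rfl⟩
    rw [h, ih _ (hx.mono (by simp))]

theorem tupleSum_congr (k : ℕ) (S : Finset α) (F G : List α → ℤ)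
    (h : ∀ l : List α, l.length = k → l.Nodup → (∀ a ∈ l, a ∈ S) → F l = G l) :
    tupleSum k S F = tupleSum k S G := by
  induction k generalizing S F G with
  | zero => exact h [] rfl List.nodup_nil (by simp)
  | succ k ih =>
    refine Finset.sum_congr rfl fun a ha => ih _ _ _ fun l hl hn hS => ?_
    refine h (a :: l) (by simp [hl]) (List.nodup_cons.2 ⟨fun hal => ?_, hn⟩) fun b hb => ?_
    · exact (Finset.mem_erase.1 (hS a hal)).1 rfl
    · rcases List.mem_cons.1 hb with rfl | hb
      · exact ha
      · exact (Finset.mem_erase.1 (hS b hb)).2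

theorem sum_list_erase (l : List α) (hl : l.Nodup) (g : α → Finset α → ℤ) :
    ∑ a ∈ l.toFinset, g a (l.toFinset.erase a) =
      (l.map fun a => g a (l.erase a).toFinset).sum := by
  rw [List.sum_toFinset _ hl]
  refine congrArg _ (List.map_congr_left fun a _ => ?_)
  congr 1
  ext b
  simp [hl.mem_erase_iff]

theorem tupleSum_toFinset (k : ℕ) (l : List α) (hl : l.Nodup) (F : List α → ℤ) :
    tupleSum (k + 1) l.toFinset F =
      (l.map fun a => tupleSum k (l.erase a).toFinset fun t => F (a :: t)).sum :=
  sum_list_erase l hl fun a S => tupleSum k S fun t => F (a :: t)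

end TupleSum

theorem dot_comm (p q : ℤ × ℤ × ℤ) : dot p q = dot q p := by
  simp only [dot]; ring

theorem pairDensity_eq {α : Type*} (E : α → α → α → Bool) (a b c d v w : α) :
    pairDensity E a b c d v w =
      22 * dot (linkWeight E a b c d v) (linkWeight E a b c d w) +
        (dot (linkWeight E a b c d v) (linkWeight E a b c d v) +
          dot (linkWeight E a b c d w) (linkWeight E a b c d w)) := by
  have h : ∀ (k : ℤ → ℤ → ℤ → ℤ) (t : WeightTree),
      t.withValue k = k t.value.1 t.value.2.1 t.value.2.2 := by
    rintro k (_ | _) <;> rfl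
  simp only [pairDensity, h, pairForm, linkWeight]

theorem tupleSum_three_density {α : Type*} [DecidableEq α] (E : α → α → α → Bool)
    (a b c x y z : α) (h : [x, y, z].Nodup) :
    tupleSum 3 [x, y, z].toFinset (fun t => density E (a :: b :: c :: t)) =
      tripleDensity E a b c x y z := by
  rw [tupleSum_toFinset _ _ h]
  simp only [List.nodup_cons, List.mem_cons, not_or, List.not_mem_nil, not_false_eq_true,
    List.nodup_nil, and_true] at h
  obtain ⟨⟨hxy, hxz⟩, hyz⟩ := h
  simp only [List.map, List.erase_cons_head, List.erase_cons_tail, hxy, hxz, hyz,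
    beq_iff_eq, not_false_eq_true, List.sum_cons, List.sum_nil]
  rw [tupleSum_toFinset _ _ (by simp [*]), tupleSum_toFinset _ _ (by simp [*]),
    tupleSum_toFinset _ _ (by simp [*])]
  simp only [List.map, List.erase_cons_head, List.erase_cons_tail, hxy, hxz, hyz,
    beq_iff_eq, not_false_eq_true, List.sum_cons, List.sum_nil]
  simp only [tupleSum, List.toFinset_cons, List.toFinset_nil, insert_empty_eq,
    Finset.sum_singleton, density, tripleDensity, pairDensity_eq, cut]
  rw [dot_comm (linkWeight E a b c x z) (linkWeight E a b c x y),
    dot_comm (linkWeight E a b c y z) (linkWeight E a b c y x),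
    dot_comm (linkWeight E a b c z y) (linkWeight E a b c z x)]
  rcases E a b c
  · generalize starLink E a b c x = p
    generalize starLink E a b c y = q
    generalize starLink E a b c z = r
    generalize E a b x = p'
    generalize E a b y = q'
    generalize E a b z = r'
    have hp : byCount 90660 (-66484) 12088 326376 p q r =
      (bif p then (bif q then 54396 else -63462) else 15110) +
      (bif p then (bif r then 54396 else -63462) else 15110) +
      (bif q then (bif p then 54396 else -63462) else 15110) +
      (bif q then (bif r then 54396 else -63462) else 15110) +
      (bif r then (bif p then 54396 else -63462) else 15110) +
      (bif r then (bif q then 54396 else -63462) else 15110) := by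
      cases p <;> cases q <;> cases r <;> rfl
    have hq : byCount 49212 (-57414) 49212 369090 p' q' r' =
      (bif p' then (bif q' then 61515 else -45111) else 8202) +
      (bif p' then (bif r' then 61515 else -45111) else 8202) +
      (bif q' then (bif p' then 61515 else -45111) else 8202) +
      (bif q' then (bif r' then 61515 else -45111) else 8202) +
      (bif r' then (bif p' then 61515 else -45111) else 8202) +
      (bif r' then (bif q' then 61515 else -45111) else 8202) := by
      cases p' <;> cases q' <;> cases r' <;> rfl
    rw [hp, hq]
    simp only [cond_false]
    ring
  · simp only [cond_true]
    ring

theorem tupleSum_six_density {α : Type*} [DecidableEq α] (E : α → α → α → Bool)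
    (a b c d e f : α) (h : [a, b, c, d, e, f].Nodup) :
    tupleSum 6 [a, b, c, d, e, f].toFinset (density E) = totalDensity E a b c d e f := by
  have hfour : ∀ (u v a b c d : α), [a, b, c, d].Nodup →
      tupleSum 4 [a, b, c, d].toFinset (fun t => density E (u :: v :: t)) =
        pickFour (tripleDensity E u v) a b c d := by
    intro u v a b c d h
    rw [tupleSum_toFinset _ _ h]
    simp only [List.nodup_cons, List.mem_cons, not_or, List.not_mem_nil, not_false_eq_true,
      List.nodup_nil, and_true] at h
    obtain ⟨⟨hab, hac, had⟩, ⟨hbc, hbd⟩, hcd⟩ := h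
    simp only [List.map, List.erase_cons_head, List.erase_cons_tail, hab, hac, had, hbc, hbd, hcd,
      beq_iff_eq, not_false_eq_true, List.sum_cons, List.sum_nil, pickFour, add_zero]
    rw [tupleSum_three_density _ _ _ _ _ _ _ (by simp [*]),
      tupleSum_three_density _ _ _ _ _ _ _ (by simp [*]),
      tupleSum_three_density _ _ _ _ _ _ _ (by simp [*]),
      tupleSum_three_density _ _ _ _ _ _ _ (by simp [*])]
  have hfive : ∀ (u a b c d e : α), [a, b, c, d, e].Nodup →
      tupleSum 5 [a, b, c, d, e].toFinset (fun t => density E (u :: t)) =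
        pickFive (fun b => pickFour (tripleDensity E u b)) a b c d e := by
    intro u a b c d e h
    rw [tupleSum_toFinset _ _ h]
    simp only [List.nodup_cons, List.mem_cons, not_or, List.not_mem_nil, not_false_eq_true,
      List.nodup_nil, and_true] at h
    obtain ⟨⟨hab, hac, had, hae⟩, ⟨hbc, hbd, hbe⟩, ⟨hcd, hce⟩, hde⟩ := h
    simp only [List.map, List.erase_cons_head, List.erase_cons_tail, hab, hac, had, hae, hbc, hbd,
      hbe, hcd, hce, hde, beq_iff_eq, not_false_eq_true, List.sum_cons, List.sum_nil,
      pickFive, add_zero]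
    rw [hfour _ _ _ _ _ _ (by simp [*]), hfour _ _ _ _ _ _ (by simp [*]),
      hfour _ _ _ _ _ _ (by simp [*]), hfour _ _ _ _ _ _ (by simp [*]),
      hfour _ _ _ _ _ _ (by simp [*])]
  rw [tupleSum_toFinset _ _ h]
  simp only [List.nodup_cons, List.mem_cons, not_or, List.not_mem_nil, not_false_eq_true,
    List.nodup_nil, and_true] at h
  obtain ⟨⟨hab, hac, had, hae, haf⟩, ⟨hbc, hbd, hbe, hbf⟩, ⟨hcd, hce, hcf⟩, ⟨hde, hdf⟩, hef⟩ := h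
  simp only [List.map, List.erase_cons_head, List.erase_cons_tail, hab, hac, had, hae, haf, hbc,
    hbd, hbe, hbf, hcd, hce, hcf, hde, hdf, hef, beq_iff_eq, not_false_eq_true,
    List.sum_cons, List.sum_nil, totalDensity, pickSix, add_zero]
  rw [hfive _ _ _ _ _ _ (by simp [*]), hfive _ _ _ _ _ _ (by simp [*]),
    hfive _ _ _ _ _ _ (by simp [*]), hfive _ _ _ _ _ _ (by simp [*]),
    hfive _ _ _ _ _ _ (by simp [*]), hfive _ _ _ _ _ _ (by simp [*])]

section Positivity

variable {α : Type*} [DecidableEq α]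

theorem sum_sum_erase_dot (R : Finset α) (hR : R.card = 12) (W : α → ℤ × ℤ × ℤ) (g : α → ℤ) :
    11 * ∑ v ∈ R, g v ≤
      ∑ v ∈ R, ∑ w ∈ R.erase v, (11 * dot (W v) (W w) + (dot (W v) (W v) + g v)) := by
  have h : ∀ v ∈ R, ∑ w ∈ R.erase v, (11 * dot (W v) (W w) + (dot (W v) (W v) + g v)) =
      11 * ((W v).1 * ∑ w ∈ R, (W w).1 + ((W v).2.1 * ∑ w ∈ R, (W w).2.1 +
        (W v).2.2 * ∑ w ∈ R, (W w).2.2)) + 11 * g v := by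
    intro v hv
    rw [Finset.sum_add_distrib, Finset.sum_const, Finset.card_erase_of_mem hv, hR,
      Finset.sum_erase_eq_sub hv, ← Finset.mul_sum]
    simp only [dot, Finset.sum_add_distrib, ← Finset.mul_sum]
    rw [nsmul_eq_mul]
    push_cast
    ring
  rw [Finset.sum_congr rfl h]
  simp only [Finset.sum_add_distrib, ← Finset.mul_sum, ← Finset.sum_mul]
  nlinarith [mul_self_nonneg (∑ w ∈ R, (W w).1), mul_self_nonneg (∑ w ∈ R, (W w).2.1),
    mul_self_nonneg (∑ w ∈ R, (W w).2.2)]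

theorem sum_sum_erase_cond (Q : Finset α) (hQ : Q.card = 13) (p : α → Bool) (A B C : ℤ) :
    ∑ d ∈ Q, ∑ v ∈ Q.erase d, (bif p d then (bif p v then A else B) else C) =
      156 * C + 12 * (B - C) * (∑ v ∈ Q, bif p v then 1 else 0) +
        (A - B) * ((∑ v ∈ Q, bif p v then 1 else 0) ^ 2 - ∑ v ∈ Q, bif p v then 1 else 0) := by
  have h : ∀ d ∈ Q, ∑ v ∈ Q.erase d, (bif p d then (bif p v then A else B) else C) =
      12 * C + (12 * (B - C) + (A - B) * ((∑ v ∈ Q, bif p v then 1 else 0) - 1)) *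
        (bif p d then 1 else 0) := by
    intro d hd
    cases hp : p d
    · simp [Finset.card_erase_of_mem hd, hQ]
    · have h' : ∀ v, (bif p v then A else B) = B + (A - B) * (bif p v then 1 else 0) := by
        intro v
        cases p v <;> simp
      simp only [cond_true, h', Finset.sum_add_distrib, ← Finset.mul_sum,
        Finset.sum_erase_eq_sub hd, Finset.sum_const, hQ, hp]
      rw [nsmul_eq_mul]
      push_cast
      ring
  rw [Finset.sum_congr rfl h]
  simp only [Finset.sum_add_distrib, ← Finset.mul_sum, Finset.sum_const, hQ]
  rw [nsmul_eq_mul]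
  push_cast
  ring

theorem sum_sum_cut_nonneg (Q : Finset α) (hQ : Q.card = 13) (E : α → α → α → Bool)
    (a b c : α) : 0 ≤ ∑ d ∈ Q, ∑ v ∈ Q.erase d, cut E a b c d v := by
  have hprod : ∀ z k : ℤ, 0 ≤ (z - k) * (z - (k + 1)) := by
    intro z k
    rcases le_or_gt z k with h | h
    · exact mul_nonneg_of_nonpos_of_nonpos (by linarith) (by linarith)
    · exact mul_nonneg (by linarith) (by linarith [Int.add_one_le_iff.2 h])
  cases h : E a b c
  · simp only [cut, h, cond_false, Finset.sum_add_distrib]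
    rw [sum_sum_erase_cond Q hQ (starLink E a b c), sum_sum_erase_cond Q hQ (E a b)]
    nlinarith [hprod (∑ v ∈ Q, bif starLink E a b c v then 1 else 0) 4,
      hprod (∑ v ∈ Q, bif E a b v then 1 else 0) 3]
  · simp [cut, h]

theorem tupleSum_density_nonneg (U : Finset α) (hU : U.card = 16) (E : α → α → α → Bool) :
    0 ≤ tupleSum 6 U (density E) := by
  simp only [tupleSum, density]
  refine Finset.sum_nonneg fun a ha => Finset.sum_nonneg fun b hb =>
    Finset.sum_nonneg fun c hc => ?_
  have hQ : (((U.erase a).erase b).erase c).card = 13 := by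
    rw [Finset.card_erase_of_mem hc, Finset.card_erase_of_mem hb, Finset.card_erase_of_mem ha, hU]
  generalize ((U.erase a).erase b).erase c = Q at hQ
  calc 0 ≤ 11 * ∑ d ∈ Q, ∑ v ∈ Q.erase d, cut E a b c d v :=
        mul_nonneg (by norm_num) (sum_sum_cut_nonneg Q hQ E a b c)
    _ ≤ _ := by
        rw [Finset.mul_sum]
        refine Finset.sum_le_sum fun d hd => ?_
        exact sum_sum_erase_dot _ (by rw [Finset.card_erase_of_mem hd, hQ])
          (linkWeight E a b c d) (cut E a b c d)

end Positivity

section Masks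

/-- The position of the bit of a triple in a mask. -/
def tripleIndex (a b c : ℕ) : ℕ := 63 - (a + (b + c))

theorem maskEdge_eq_testBit (m a b c : ℕ) : maskEdge m a b c = m.testBit (tripleIndex a b c) := by
  have h : maskEdge m a b c = Nat.beq (1 &&& (m >>> tripleIndex a b c)) 1 := rfl
  rw [h, Nat.testBit, Nat.one_and_eq_mod_two]
  rcases Nat.mod_two_eq_zero_or_one (m >>> tripleIndex a b c) with h | h <;> rw [h] <;> rfl

theorem tripleBit_eq (t : ℕ × ℕ × ℕ) : tripleBit t = 2 ^ tripleIndex t.1 t.2.1 t.2.2 := by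
  have h : tripleBit t = 1 <<< (63 - (t.1 + t.2.1 + t.2.2)) := rfl
  rw [h, Nat.one_shiftLeft, tripleIndex, add_assoc]

theorem testBit_lor_tripleBit (m : ℕ) (t : ℕ × ℕ × ℕ) (i : ℕ) :
    (Nat.lor m (tripleBit t)).testBit i = true ↔
      m.testBit i = true ∨ tripleIndex t.1 t.2.1 t.2.2 = i := by
  have h : Nat.lor m (tripleBit t) = m ||| tripleBit t := rfl
  rw [h, Nat.testBit_or, tripleBit_eq, Nat.testBit_two_pow]
  simp

theorem testBit_addMask (p : ℕ → ℕ → ℕ → Bool) (ts : List (ℕ × ℕ × ℕ)) (m i : ℕ) :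
    (addMask p ts m).testBit i = true ↔ m.testBit i = true ∨
      ∃ t ∈ ts, p t.1 t.2.1 t.2.2 = true ∧ tripleIndex t.1 t.2.1 t.2.2 = i := by
  induction ts generalizing m with
  | nil => simp [addMask]
  | cons t ts ih =>
    rw [addMask, ih]
    cases h : p t.1 t.2.1 t.2.2
    · simp [h]
    · simp only [cond_true, testBit_lor_tripleBit, List.mem_cons, exists_eq_or_imp, h, true_and,
        or_assoc]

theorem addMask_append (p : ℕ → ℕ → ℕ → Bool) (ts us : List (ℕ × ℕ × ℕ)) (m : ℕ) :
    addMask p (ts ++ us) m = addMask p us (addMask p ts m) := by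
  induction ts generalizing m with
  | nil => rfl
  | cons t ts ih => exact ih _

theorem addMask_congr (p q : ℕ → ℕ → ℕ → Bool) (ts : List (ℕ × ℕ × ℕ)) (m : ℕ)
    (h : ∀ t ∈ ts, p t.1 t.2.1 t.2.2 = q t.1 t.2.1 t.2.2) : addMask p ts m = addMask q ts m := by
  induction ts generalizing m with
  | nil => rfl
  | cons t ts ih =>
    rw [addMask, addMask, h t List.mem_cons_self, ih _ fun u hu => h u (List.mem_cons_of_mem _ hu)]

theorem le_addMask (p : ℕ → ℕ → ℕ → Bool) (ts : List (ℕ × ℕ × ℕ)) (m : ℕ) :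
    m ≤ addMask p ts m := by
  induction ts generalizing m with
  | nil => exact le_rfl
  | cons t ts ih =>
    rw [addMask]
    refine le_trans ?_ (ih _)
    cases p t.1 t.2.1 t.2.2
    · exact le_rfl
    · exact Nat.left_le_or

theorem or_le_add (m n : ℕ) : m ||| n ≤ m + n := by
  induction m using Nat.strong_induction_on generalizing n with
  | _ m ih =>
    rcases Nat.eq_zero_or_pos m with rfl | hm
    · simp
    · have h₁ := ih (m / 2) (Nat.div_lt_self hm one_lt_two) (n / 2)
      have h₂ : (m ||| n) / 2 = m / 2 ||| n / 2 := Nat.or_div_two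
      have h₃ : (m ||| n) % 2 = 1 ↔ m % 2 = 1 ∨ n % 2 = 1 := Nat.or_mod_two_eq_one
      omega

theorem addMask_le (p : ℕ → ℕ → ℕ → Bool) (ts : List (ℕ × ℕ × ℕ)) (m : ℕ) :
    addMask p ts m ≤ m + (ts.map tripleBit).sum := by
  induction ts generalizing m with
  | nil => simp [addMask]
  | cons t ts ih =>
    rw [addMask, List.map_cons, List.sum_cons, ← add_assoc]
    refine (ih _).trans (Nat.add_le_add_right ?_ _)
    cases p t.1 t.2.1 t.2.2
    · exact Nat.le_add_right _ _
    · exact or_le_add m (tripleBit t)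

theorem names_of_mem_allTriples : ∀ t ∈ allTriples, t.1 ∈ names ∧ t.2.1 ∈ names ∧ t.2.2 ∈ names ∧
    t.1 ≠ t.2.1 ∧ t.1 ≠ t.2.2 ∧ t.2.1 ≠ t.2.2 := by
  decide +kernel

theorem ne_of_mem_innerTriples : ∀ t ∈ innerTriples, t.1 ≠ 32 ∧ t.2.1 ≠ 32 ∧ t.2.2 ≠ 32 := by
  decide +kernel

theorem mem_innerTriples_of_ne : ∀ t ∈ allTriples, 32 ≠ t.1 → 32 ≠ t.2.1 → 32 ≠ t.2.2 →
    t ∈ innerTriples := by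
  decide +kernel

theorem exists_allTriples_tripleIndex_eq : ∀ a ∈ names, ∀ b ∈ names, ∀ c ∈ names,
    a ≠ b → a ≠ c → b ≠ c →
      ∃ t ∈ allTriples, tripleIndex t.1 t.2.1 t.2.2 = tripleIndex a b c := by
  decide +kernel

theorem exists_innerTriples_tripleIndex_eq : ∀ a ∈ names, ∀ b ∈ names, ∀ c ∈ names,
    a ≠ b → a ≠ c → b ≠ c → a ≠ 32 → b ≠ 32 → c ≠ 32 →
      ∃ t ∈ innerTriples, tripleIndex t.1 t.2.1 t.2.2 = tripleIndex a b c := by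
  decide +kernel

theorem eq_of_tripleIndex_eq : ∀ t ∈ allTriples, ∀ a ∈ names, ∀ b ∈ names, ∀ c ∈ names,
    a ≠ b → a ≠ c → b ≠ c → tripleIndex t.1 t.2.1 t.2.2 = tripleIndex a b c →
      t = (a, b, c) ∨ t = (a, c, b) ∨ t = (b, a, c) ∨ t = (b, c, a) ∨ t = (c, a, b) ∨
        t = (c, b, a) := by
  decide +kernel

theorem applyPerm_names : ∀ l ∈ innerPerms ++ outerPerms,
    names.toFinset.image (applyPerm l) = names.toFinset := by
  decide +kernel

theorem applyPerm_ne : ∀ l ∈ innerPerms, ∀ a ∈ names, a ≠ 32 → applyPerm l a ≠ 32 := by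
  decide +kernel

theorem applyPerm_injOn (l : List ℕ) (hl : l ∈ innerPerms ++ outerPerms) :
    Set.InjOn (applyPerm l) names.toFinset :=
  Finset.injOn_of_card_image_eq (by rw [applyPerm_names l hl])

theorem applyPerm_mem (l : List ℕ) (hl : l ∈ innerPerms ++ outerPerms) (a : ℕ) (ha : a ∈ names) :
    applyPerm l a ∈ names := by
  have h := Finset.mem_image_of_mem (applyPerm l) (List.mem_toFinset.2 ha)
  rwa [applyPerm_names l hl, List.mem_toFinset] at h

theorem density_congr {α : Type*} (E E' : α → α → α → Bool) (l : List α) (hl : l.Nodup)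
    (h : ∀ a ∈ l, ∀ b ∈ l, ∀ c ∈ l, a ≠ b → a ≠ c → b ≠ c → E a b c = E' a b c) :
    density E l = density E' l := by
  match l, hl, h with
  | [a, b, c, d, v, w], hl, h =>
    simp only [List.nodup_cons, List.mem_cons, not_or, List.not_mem_nil, not_false_eq_true,
      List.nodup_nil, and_true] at hl
    obtain ⟨⟨hab, hac, had, hav, haw⟩, ⟨hbc, hbd, hbv, hbw⟩, ⟨hcd, hcv, hcw⟩, ⟨hdv, hdw⟩, -⟩ := hl
    simp only [density, linkWeight, linkTree, typeTree, cut, starLink,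
      h a (by simp) b (by simp) c (by simp) hab hac hbc,
      h a (by simp) b (by simp) d (by simp) hab had hbd,
      h a (by simp) c (by simp) d (by simp) hac had hcd,
      h b (by simp) c (by simp) d (by simp) hbc hbd hcd,
      h a (by simp) b (by simp) v (by simp) hab hav hbv,
      h a (by simp) c (by simp) v (by simp) hac hav hcv,
      h a (by simp) d (by simp) v (by simp) had hav hdv,
      h b (by simp) c (by simp) v (by simp) hbc hbv hcv,
      h b (by simp) d (by simp) v (by simp) hbd hbv hdv,
      h c (by simp) d (by simp) v (by simp) hcd hcv hdv,
      h a (by simp) b (by simp) w (by simp) hab haw hbw,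
      h a (by simp) c (by simp) w (by simp) hac haw hcw,
      h a (by simp) d (by simp) w (by simp) had haw hdw,
      h b (by simp) c (by simp) w (by simp) hbc hbw hcw,
      h b (by simp) d (by simp) w (by simp) hbd hbw hdw,
      h c (by simp) d (by simp) w (by simp) hcd hcw hdw]
  | [], _, _ => rfl
  | [_], _, _ => rfl
  | [_, _], _, _ => rfl
  | [_, _, _], _, _ => rfl
  | [_, _, _, _], _, _ => rfl
  | [_, _, _, _, _], _, _ => rfl
  | _ :: _ :: _ :: _ :: _ :: _ :: _ :: _, _, _ => rfl

/-- A predicate on triples that does not depend on their order. -/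
def IsSymmetric {α : Type*} (P : α → α → α → Bool) : Prop :=
  (∀ a b c, P a b c = P b a c) ∧ ∀ a b c, P a b c = P a c b

theorem IsSymmetric.eq_of_tripleIndex_eq {P : ℕ → ℕ → ℕ → Bool} (hP : IsSymmetric P)
    {t : ℕ × ℕ × ℕ} (ht : t ∈ allTriples) {a b c : ℕ} (ha : a ∈ names) (hb : b ∈ names)
    (hc : c ∈ names) (hab : a ≠ b) (hac : a ≠ c) (hbc : b ≠ c)
    (h : tripleIndex t.1 t.2.1 t.2.2 = tripleIndex a b c) : P t.1 t.2.1 t.2.2 = P a b c := by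
  obtain ⟨h₁, h₂⟩ := hP
  rcases _root_.eq_of_tripleIndex_eq t ht a ha b hb c hc hab hac hbc h with
    rfl | rfl | rfl | rfl | rfl | rfl
  · rfl
  · exact h₂ _ _ _
  · exact h₁ _ _ _
  · exact (h₂ _ _ _).trans (h₁ _ _ _)
  · exact (h₁ _ _ _).trans (h₂ _ _ _)
  · exact (h₁ _ _ _).trans ((h₂ _ _ _).trans (h₁ _ _ _))

theorem maskEdge_addMask {P : ℕ → ℕ → ℕ → Bool} (hP : IsSymmetric P) {ts : List (ℕ × ℕ × ℕ)}
    (hts : ts ⊆ allTriples) {a b c : ℕ} (ha : a ∈ names) (hb : b ∈ names) (hc : c ∈ names)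
    (hab : a ≠ b) (hac : a ≠ c) (hbc : b ≠ c)
    (h : ∃ t ∈ ts, tripleIndex t.1 t.2.1 t.2.2 = tripleIndex a b c) :
    maskEdge (addMask P ts 0) a b c = P a b c := by
  rw [maskEdge_eq_testBit, Bool.eq_iff_iff, testBit_addMask]
  simp only [Nat.zero_testBit, Bool.false_eq_true, false_or]
  constructor
  · rintro ⟨t, ht, htP, hti⟩
    rwa [← hP.eq_of_tripleIndex_eq (hts ht) ha hb hc hab hac hbc hti]
  · obtain ⟨t, ht, hti⟩ := h
    intro hPabc
    exact ⟨t, ht, by rwa [hP.eq_of_tripleIndex_eq (hts ht) ha hb hc hab hac hbc hti], hti⟩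

end Masks

section Soundness

/-- No four names span three triples satisfying `P`. -/
def NoThreeOnFour (P : ℕ → ℕ → ℕ → Bool) : Prop :=
  ∀ a ∈ names, ∀ b ∈ names, ∀ c ∈ names, ∀ d ∈ names, a ≠ b → a ≠ c → a ≠ d → b ≠ c → b ≠ d →
    c ≠ d → P a b c = true → P a b d = true → P a c d = true → False

/-- Every edge of the mask `m` satisfies `P`. -/
def MaskBelow (m : ℕ) (P : ℕ → ℕ → ℕ → Bool) : Prop :=
  ∀ a ∈ names, ∀ b ∈ names, ∀ c ∈ names, a ≠ b → a ≠ c → b ≠ c →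
    maskEdge m a b c = true → P a b c = true

theorem blocked_eq_false {P : ℕ → ℕ → ℕ → Bool} (hP : IsSymmetric P) (hP4 : NoThreeOnFour P)
    {m : ℕ} (hm : MaskBelow m P) {t : ℕ × ℕ × ℕ} (ht : t ∈ allTriples)
    (hPt : P t.1 t.2.1 t.2.2 = true) : blocked m t = false := by
  obtain ⟨a, b, c⟩ := t
  obtain ⟨ha, hb, hc, hab, hac, hbc⟩ := names_of_mem_allTriples _ ht
  obtain ⟨h₁, h₂⟩ := hP
  rw [Bool.eq_false_iff]
  intro h
  simp only [blocked, List.any_eq_true, Bool.and_eq_true, Bool.or_eq_true, Bool.not_eq_true',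
    Bool.or_eq_false_iff] at h hPt ha hb hc hab hac hbc
  obtain ⟨d, hd, ⟨⟨hda, hdb⟩, hdc⟩, h⟩ := h
  have had : a ≠ d := Ne.symm (Nat.ne_of_beq_eq_false hda)
  have hbd : b ≠ d := Ne.symm (Nat.ne_of_beq_eq_false hdb)
  have hcd : c ≠ d := Ne.symm (Nat.ne_of_beq_eq_false hdc)
  have h3 := hm a ha b hb d hd hab had hbd
  have h4 := hm a ha c hc d hd hac had hcd
  have h5 := hm b hb c hc d hd hbc hbd hcd
  rcases h with ⟨h, h' | h'⟩ | ⟨h, h'⟩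
  · exact hP4 a ha b hb c hc d hd hab hac had hbc hbd hcd hPt
      (h3 h) (h4 h')
  · exact hP4 b hb a ha c hc d hd (Ne.symm hab) hbc hbd hac had hcd
      (by rwa [h₁]) (by rw [h₁]; exact h3 h) (h5 h')
  · exact hP4 c hc a ha b hb d hd (Ne.symm hac) (Ne.symm hbc) hcd hab had
      hbd (by rwa [h₁, h₂]) (by rw [h₁]; exact h4 h) (by rw [h₁]; exact h5 h')

theorem MaskBelow.lor_tripleBit {P : ℕ → ℕ → ℕ → Bool} (hP : IsSymmetric P) {m : ℕ}
    (hm : MaskBelow m P) {t : ℕ × ℕ × ℕ} (ht : t ∈ allTriples)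
    (hPt : P t.1 t.2.1 t.2.2 = true) : MaskBelow (Nat.lor m (tripleBit t)) P := by
  intro a ha b hb c hc hab hac hbc h
  rw [maskEdge_eq_testBit, testBit_lor_tripleBit] at h
  rcases h with h | h
  · exact hm a ha b hb c hc hab hac hbc (by rwa [maskEdge_eq_testBit])
  · rwa [← hP.eq_of_tripleIndex_eq ht ha hb hc hab hac hbc h]

theorem maskBelow_zero (P : ℕ → ℕ → ℕ → Bool) : MaskBelow 0 P := by
  intro a _ b _ c _ _ _ _ h
  simp [maskEdge_eq_testBit] at h

theorem MaskBelow.addMask {P : ℕ → ℕ → ℕ → Bool} (hP : IsSymmetric P) {ts : List (ℕ × ℕ × ℕ)}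
    (hts : ts ⊆ allTriples) {m : ℕ} (hm : MaskBelow m P) : MaskBelow (addMask P ts m) P := by
  induction ts generalizing m with
  | nil => exact hm
  | cons t ts ih =>
    rw [List.cons_subset] at hts
    rw [_root_.addMask]
    refine ih hts.2 ?_
    cases h : P t.1 t.2.1 t.2.2
    · exact hm
    · exact hm.lor_tripleBit hP hts.1 h

theorem of_extendAll {P : ℕ → ℕ → ℕ → Bool} (hP : IsSymmetric P) (hP4 : NoThreeOnFour P)
    {k : ℕ → Bool} {ts : List (ℕ × ℕ × ℕ)} (hts : ts ⊆ allTriples) {m : ℕ} (hm : MaskBelow m P)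
    (h : extendAll k ts m = true) : k (addMask P ts m) = true := by
  induction ts generalizing m with
  | nil => cases m <;> exact h
  | cons t ts ih =>
    rw [List.cons_subset] at hts
    rw [extendAll, Bool.and_eq_true] at h
    rw [addMask]
    cases hPt : P t.1 t.2.1 t.2.2
    · exact ih hts.2 hm h.1
    · rw [blocked_eq_false hP hP4 hm hts.1 hPt, Bool.false_or] at h
      exact ih hts.2 (hm.lor_tripleBit hP hts.1 hPt) h.2

theorem emptyFive_eq_false {m : ℕ} {P : ℕ → ℕ → ℕ → Bool} {ts : List (ℕ × ℕ × ℕ)} {d : ℕ}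
    {t : ℕ × ℕ × ℕ} (ht : t ∈ ts) (h₁ : d ≠ t.1) (h₂ : d ≠ t.2.1) (h₃ : d ≠ t.2.2)
    (hm : maskEdge m t.1 t.2.1 t.2.2 = P t.1 t.2.1 t.2.2) (hPt : P t.1 t.2.1 t.2.2 = true) :
    emptyFive ts m d = false := by
  rw [Bool.eq_false_iff]
  intro h
  have h := List.all_eq_true.1 h t ht
  simp [h₁, h₂, h₃, hm, hPt] at h

theorem permMask_addMask {P : ℕ → ℕ → ℕ → Bool} {ts : List (ℕ × ℕ × ℕ)} (hts : ts ⊆ allTriples)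
    {l : List ℕ} (hl : l ∈ innerPerms ++ outerPerms) {m : ℕ}
    (h : ∀ a ∈ names, ∀ b ∈ names, ∀ c ∈ names, a ≠ b → a ≠ c → b ≠ c →
      (∃ t ∈ ts, applyPerm l t.1 = a ∧ applyPerm l t.2.1 = b ∧ applyPerm l t.2.2 = c) →
      maskEdge m a b c = P a b c) :
    permMask ts m l =
      addMask (fun a b c => P (applyPerm l a) (applyPerm l b) (applyPerm l c)) ts 0 := by
  refine addMask_congr _ _ _ _ fun t ht => ?_
  obtain ⟨ha, hb, hc, hab, hac, hbc⟩ := names_of_mem_allTriples t (hts ht)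
  have hinj := applyPerm_injOn l hl
  refine h _ (applyPerm_mem l hl _ ha) _ (applyPerm_mem l hl _ hb) _ (applyPerm_mem l hl _ hc)
    (hinj.ne ?_ ?_ hab) (hinj.ne ?_ ?_ hac) (hinj.ne ?_ ?_ hbc) ⟨t, ht, rfl, rfl, rfl⟩ <;> simpa

theorem innerTriples_subset : innerTriples ⊆ allTriples := List.subset_append_left _ _

theorem outerTriples_subset : outerTriples ⊆ allTriples := List.subset_append_right _ _

theorem extendAll_innerCheck : extendAll innerCheck innerTriples 0 = true := by
  decide +kernel

theorem tupleSum_names_density_neg {P : ℕ → ℕ → ℕ → Bool} (hP : IsSymmetric P)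
    (hP4 : NoThreeOnFour P)
    (hP5 : ∀ d ∈ names, ∃ t ∈ allTriples, d ≠ t.1 ∧ d ≠ t.2.1 ∧ d ≠ t.2.2 ∧
      P t.1 t.2.1 t.2.2 = true)
    (hmax : ∀ l ∈ innerPerms ++ outerPerms,
      addMask (fun a b c => P (applyPerm l a) (applyPerm l b) (applyPerm l c)) allTriples 0 ≤
        addMask P allTriples 0) :
    tupleSum 6 names.toFinset (density P) < 0 := by
  have hall : ∀ a ∈ names, ∀ b ∈ names, ∀ c ∈ names, a ≠ b → a ≠ c → b ≠ c →
      maskEdge (addMask P allTriples 0) a b c = P a b c := fun a ha b hb c hc hab hac hbc =>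
    maskEdge_addMask hP (List.Subset.refl _) ha hb hc hab hac hbc
      (exists_allTriples_tripleIndex_eq a ha b hb c hc hab hac hbc)
  have hsplit : addMask P allTriples 0 = addMask P outerTriples (addMask P innerTriples 0) :=
    addMask_append _ _ _ _
  have hbelow : MaskBelow (addMask P innerTriples 0) P :=
    (maskBelow_zero P).addMask hP innerTriples_subset
  have hinner := of_extendAll hP hP4 innerTriples_subset (maskBelow_zero P) extendAll_innerCheck
  simp only [innerCheck, Bool.or_eq_true, List.any_eq_true] at hinner
  rcases hinner with (h | ⟨l, hl, h⟩) | h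
  · obtain ⟨t, ht, h₁, h₂, h₃, hPt⟩ := hP5 32 (by decide)
    have ht' := mem_innerTriples_of_ne t ht h₁ h₂ h₃
    obtain ⟨ha, hb, hc, hab, hac, hbc⟩ := names_of_mem_allTriples t ht
    rw [emptyFive_eq_false ht' h₁ h₂ h₃
      (maskEdge_addMask hP innerTriples_subset ha hb hc hab hac hbc ⟨t, ht', rfl⟩) hPt] at h
    cases h
  · have hl' : l ∈ innerPerms ++ outerPerms := List.mem_append_left _ hl
    rw [Nat.ble_eq, permMask_addMask (P := P) innerTriples_subset hl'] at h
    · have h₁ := addMask_le P outerTriples (addMask P innerTriples 0)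
      have h₂ : (outerTriples.map tripleBit).sum < 4294967296 := by decide +kernel
      have h₃ := hmax l hl'
      have h₄ := le_addMask (fun a b c => P (applyPerm l a) (applyPerm l b) (applyPerm l c))
        outerTriples (addMask (fun a b c => P (applyPerm l a) (applyPerm l b) (applyPerm l c))
          innerTriples 0)
      rw [← addMask_append] at h₄
      rw [hsplit] at h₃
      have h₅ := h₄.trans h₃
      omega
    · rintro a ha b hb c hc hab hac hbc ⟨t, ht, rfl, rfl, rfl⟩
      obtain ⟨ha', hb', hc', -⟩ := names_of_mem_allTriples t (innerTriples_subset ht)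
      obtain ⟨h₁, h₂, h₃⟩ := ne_of_mem_innerTriples t ht
      exact maskEdge_addMask hP innerTriples_subset ha hb hc hab hac hbc
        (exists_innerTriples_tripleIndex_eq _ ha _ hb _ hc hab hac hbc (applyPerm_ne l hl _ ha' h₁)
          (applyPerm_ne l hl _ hb' h₂) (applyPerm_ne l hl _ hc' h₃))
  · have houter := of_extendAll hP hP4 outerTriples_subset hbelow h
    rw [← hsplit] at houter
    simp only [leafCheck, Bool.or_eq_true, List.any_eq_true, decide_eq_true_eq] at houter
    rcases houter with (⟨d, hd, h⟩ | ⟨l, hl, h⟩) | h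
    · obtain ⟨t, ht, h₁, h₂, h₃, hPt⟩ := hP5 d hd
      obtain ⟨ha, hb, hc, hab, hac, hbc⟩ := names_of_mem_allTriples t ht
      rw [emptyFive_eq_false ht h₁ h₂ h₃
        (hall _ ha _ hb _ hc hab hac hbc) hPt] at h
      cases h
    · have hl' : l ∈ innerPerms ++ outerPerms := List.mem_append_right _ hl
      rw [Nat.ble_eq, permMask_addMask (P := P)
        (List.Subset.refl _) hl' fun a ha b hb c hc hab hac hbc _ =>
          hall a ha b hb c hc hab hac hbc] at h
      exact absurd (hmax l hl') (not_le.2 h)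
    · rw [← tupleSum_six_density _ _ _ _ _ _ _ (by decide)] at h
      refine lt_of_eq_of_lt (tupleSum_congr _ _ _ _ fun l _ hl hmem => ?_) h
      refine density_congr _ _ l hl fun a ha b hb c hc hab hac hbc => ?_
      exact (hall a (List.mem_toFinset.1 (hmem a ha)) b (List.mem_toFinset.1 (hmem b hb)) c
        (List.mem_toFinset.1 (hmem c hc)) hab hac hbc).symm

theorem tupleSum_density_neg {V : Type*} [DecidableEq V] (f : Finset V → Bool)
    (h4 : ∀ a b c d : V, a ≠ b → a ≠ c → a ≠ d → b ≠ c → b ≠ d → c ≠ d →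
      f {a, b, c} = true → f {a, b, d} = true → f {a, c, d} = true → False)
    (h5 : ∀ T : Finset V, T.card = 5 → ∃ t ⊆ T, t.card = 3 ∧ f t = true)
    (S : Finset V) (hS : S.card = 6) :
    tupleSum 6 S (density fun a b c => f {a, b, c}) < 0 := by
  let X : Set (ℕ → V) := {x | Set.InjOn x names.toFinset ∧ names.toFinset.image x = S}
  let M : (ℕ → V) → ℕ := fun x => addMask (fun a b c => f {x a, x b, x c}) allTriples 0
  have hXne : X.Nonempty := by
    have hcard : names.toFinset.card = S.card := by rw [hS]; decide
    obtain ⟨v, -⟩ : S.Nonempty := Finset.card_pos.1 (by omega)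
    let e := Finset.equivOfCardEq hcard
    have he : ∀ (a : ℕ) (ha : a ∈ names.toFinset),
        (if h : a ∈ names.toFinset then (e ⟨a, h⟩ : V) else v) = e ⟨a, ha⟩ := fun a ha => dif_pos ha
    refine ⟨fun a => if h : a ∈ names.toFinset then e ⟨a, h⟩ else v, ?_, ?_⟩
    · intro a ha b hb hab
      rw [Finset.mem_coe] at ha hb
      simp only [he a ha, he b hb] at hab
      exact congrArg Subtype.val (e.injective (Subtype.ext hab))
    · ext w
      rw [Finset.mem_image]
      constructor
      · rintro ⟨a, ha, rfl⟩
        simp only [he a ha]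
        exact (e ⟨a, ha⟩).2
      · intro hw
        refine ⟨e.symm ⟨w, hw⟩, (e.symm ⟨w, hw⟩).2, ?_⟩
        simp only [he _ (e.symm ⟨w, hw⟩).2]
        simp
  have hbdd : BddAbove (M '' X) := by
    refine ⟨0 + (allTriples.map tripleBit).sum, ?_⟩
    rintro _ ⟨x, -, rfl⟩
    exact addMask_le _ _ _
  obtain ⟨x, ⟨hinj, himg⟩, hxM⟩ := Nat.sSup_mem (hXne.image M) hbdd
  have hmax : ∀ y ∈ X, M y ≤ M x := fun y hy => hxM ▸ le_csSup hbdd ⟨y, hy, rfl⟩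
  have hne : ∀ {a b : ℕ}, a ∈ names → b ∈ names → a ≠ b → x a ≠ x b := fun ha hb hab =>
    hinj.ne (List.mem_toFinset.2 ha) (List.mem_toFinset.2 hb) hab
  have key : tupleSum 6 names.toFinset (density fun a b c => f {x a, x b, x c}) < 0 := by
    refine tupleSum_names_density_neg ⟨fun a b c => ?_, fun a b c => ?_⟩ ?_ ?_ ?_
    · exact congrArg f (Finset.insert_comm _ _ _)
    · exact congrArg f (congrArg _ (Finset.pair_comm _ _))
    · intro a ha b hb c hc d hd hab hac had hbc hbd hcd
      exact h4 _ _ _ _ (hne ha hb hab) (hne ha hc hac) (hne ha hd had) (hne hb hc hbc)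
        (hne hb hd hbd) (hne hc hd hcd)
    · intro d hd
      obtain ⟨t, htT, ht3, hft⟩ := h5 ((names.toFinset.erase d).image x) (by
        rw [Finset.card_image_of_injOn (hinj.mono (by simp)),
          Finset.card_erase_of_mem (List.mem_toFinset.2 hd)]
        rfl)
      obtain ⟨u, v, w, huv, huw, hvw, rfl⟩ := Finset.card_eq_three.1 ht3
      simp only [Finset.insert_subset_iff, Finset.singleton_subset_iff, Finset.mem_image,
        Finset.mem_erase, List.mem_toFinset] at htT
      obtain ⟨⟨a, ⟨had, ha⟩, rfl⟩, ⟨b, ⟨hbd, hb⟩, rfl⟩, ⟨c, ⟨hcd, hc⟩, rfl⟩⟩ := htT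
      have hab : a ≠ b := fun h => huv (h ▸ rfl)
      have hac : a ≠ c := fun h => huw (h ▸ rfl)
      have hbc : b ≠ c := fun h => hvw (h ▸ rfl)
      obtain ⟨t, ht, hti⟩ := exists_allTriples_tripleIndex_eq a ha b hb c hc hab hac hbc
      refine ⟨t, ht, ?_⟩
      rcases eq_of_tripleIndex_eq t ht a ha b hb c hc hab hac hbc hti with
        rfl | rfl | rfl | rfl | rfl | rfl <;>
      refine ⟨Ne.symm ?_, Ne.symm ?_, Ne.symm ?_, ?_⟩ <;> try assumption
      all_goals
        rw [← hft]
        congr 1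
        ext
        simp only [Finset.mem_insert, Finset.mem_singleton]
        tauto
    · intro l hl
      refine hmax (x ∘ applyPerm l) ⟨?_, ?_⟩
      · refine hinj.comp (applyPerm_injOn l hl) fun a ha => ?_
        rw [Finset.mem_coe, List.mem_toFinset] at ha ⊢
        exact applyPerm_mem l hl a ha
      · rw [← Finset.image_image, applyPerm_names l hl, himg]
  rw [← himg, tupleSum_image _ _ _ hinj]
  refine lt_of_eq_of_lt (tupleSum_congr _ _ _ _ fun l hl _ _ => ?_) key
  match l, hl with
  | [a, b, c, d, v, w], _ => rfl

end Soundness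

theorem exists_of_hasK4minus {n k : ℕ} {c : Finset (Fin n) → Fin k} {i : Fin k}
    (h : HasK4minus c i) : ∃ u v w x : Fin n, u ≠ v ∧ u ≠ w ∧ u ≠ x ∧ v ≠ w ∧ v ≠ x ∧ w ≠ x ∧
      c {u, v, w} = i ∧ c {u, v, x} = i ∧ c {u, w, x} = i := by
  obtain ⟨S, hS, h3⟩ := h
  have hsub : ((S.powersetCard 3).filter fun t => c t = i) ⊆
      (S.filter fun v => c (S.erase v) = i).image S.erase := by
    intro t ht
    rw [Finset.mem_filter, Finset.mem_powersetCard] at ht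
    obtain ⟨⟨htS, ht3⟩, hti⟩ := ht
    obtain ⟨v, hv⟩ := Finset.card_eq_one.1 (show (S \ t).card = 1 by
      rw [Finset.card_sdiff_of_subset htS, hS, ht3])
    have hvS : v ∈ S \ t := hv ▸ Finset.mem_singleton_self v
    have het : S.erase v = t := by
      rw [← Finset.sdiff_singleton_eq_erase, ← hv, Finset.sdiff_sdiff_eq_self htS]
    exact Finset.mem_image.2 ⟨v, Finset.mem_filter.2 ⟨(Finset.mem_sdiff.1 hvS).1, het ▸ hti⟩, het⟩
  obtain ⟨v, hv, w, hw, x, hx, hvw, hvx, hwx⟩ := Finset.two_lt_card.1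
    (h3.trans ((Finset.card_le_card hsub).trans Finset.card_image_le))
  rw [Finset.mem_filter] at hv hw hx
  have hvwx : {v, w, x} ⊆ S := by
    simp [Finset.insert_subset_iff, hv.1, hw.1, hx.1]
  obtain ⟨u, hu⟩ := Finset.card_eq_one.1 (show (S \ {v, w, x}).card = 1 by
    rw [Finset.card_sdiff_of_subset hvwx, hS, Finset.card_eq_three.2 ⟨v, w, x, hvw, hvx, hwx, rfl⟩])
  have huS : u ∈ S \ {v, w, x} := hu ▸ Finset.mem_singleton_self u
  have hSu : S = {u, v, w, x} := by
    rw [← Finset.sdiff_union_of_subset hvwx, hu, Finset.singleton_union]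
  simp only [Finset.mem_sdiff, Finset.mem_insert, Finset.mem_singleton, not_or] at huS
  obtain ⟨-, huv, huw, hux⟩ := huS
  refine ⟨u, v, w, x, huv, huw, hux, hvw, hvx, hwx, ?_, ?_, ?_⟩
  · rw [← hx.2, hSu]
    congr 1
    ext y
    simp only [Finset.mem_insert, Finset.mem_singleton, Finset.mem_erase]
    grind
  · rw [← hw.2, hSu]
    congr 1
    ext y
    simp only [Finset.mem_insert, Finset.mem_singleton, Finset.mem_erase]
    grind
  · rw [← hv.2, hSu]
    congr 1
    ext y
    simp only [Finset.mem_insert, Finset.mem_singleton, Finset.mem_erase]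
    grind

theorem hasK4minus_of_eq {n k : ℕ} {c : Finset (Fin n) → Fin k} {i : Fin k} {u v w x : Fin n}
    (huv : u ≠ v) (huw : u ≠ w) (hux : u ≠ x) (hvw : v ≠ w) (hvx : v ≠ x) (hwx : w ≠ x)
    (h₁ : c {u, v, w} = i) (h₂ : c {u, v, x} = i) (h₃ : c {u, w, x} = i) : HasK4minus c i := by
  refine ⟨{u, v, w, x}, by simp [*], ?_⟩
  have hsub : ({{u, v, w}, {u, v, x}, {u, w, x}} : Finset (Finset (Fin n))) ⊆
      (({u, v, w, x} : Finset (Fin n)).powersetCard 3).filter fun t => c t = i := by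
    intro t ht
    simp only [Finset.mem_insert, Finset.mem_singleton] at ht
    rw [Finset.mem_filter, Finset.mem_powersetCard]
    rcases ht with rfl | rfl | rfl
    · exact ⟨⟨by simp [Finset.insert_subset_iff], by simp [*]⟩, h₁⟩
    · exact ⟨⟨by simp [Finset.insert_subset_iff], by simp [*]⟩, h₂⟩
    · exact ⟨⟨by simp [Finset.insert_subset_iff], by simp [*]⟩, h₃⟩
  refine le_trans (le_of_eq (Finset.card_eq_three.2 ⟨_, _, _, ?_, ?_, ?_, rfl⟩).symm)
    (Finset.card_le_card hsub)
  · intro h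
    have hw : w ∈ ({u, v, x} : Finset (Fin n)) := h ▸ by simp
    simp [huw.symm, hvw.symm, hwx] at hw
  · intro h
    have hv : v ∈ ({u, w, x} : Finset (Fin n)) := h ▸ by simp
    simp [huv.symm, hvw, hvx] at hv
  · intro h
    have hv : v ∈ ({u, w, x} : Finset (Fin n)) := h ▸ by simp
    simp [huv.symm, hvw, hvx] at hv

section LowerBound

/-- The edges of a cyclic hypergraph on `ℤ/13`; the edge `{a, b, c}` is recorded as the bit
at position `2 ^ a + 2 ^ b + 2 ^ c`. -/
def cyclicMask : ℕ :=
  ([(0, 1, 2), (0, 1, 7), (0, 2, 4), (0, 3, 6), (0, 3, 8), (0, 4, 8)] : List (ℕ × ℕ × ℕ)).foldl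
    (fun m t => (List.range 13).foldl (fun m i =>
      m ||| 2 ^ (2 ^ ((t.1 + i) % 13) + (2 ^ ((t.2.1 + i) % 13) + 2 ^ ((t.2.2 + i) % 13)))) m) 0

/-- The edge relation of the cyclic hypergraph. -/
def cyclicEdge (a b c : Fin 13) : Bool := cyclicMask.testBit (2 ^ a.1 + (2 ^ b.1 + 2 ^ c.1))

set_option synthInstance.maxSize 1000 in
theorem cyclicEdge_four : ∀ a b : Fin 13, a ≠ b → ∀ c, b ≠ c → cyclicEdge a b c = true →
    ∀ d, c ≠ d → cyclicEdge a b d = true → cyclicEdge a c d = false := by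
  decide +kernel

set_option synthInstance.maxSize 1000 in
theorem cyclicEdge_five : ∀ a b : Fin 13, a < b → ∀ c, b < c → cyclicEdge a b c = false →
    ∀ d, c < d → cyclicEdge a b d = false → cyclicEdge a c d = false → cyclicEdge b c d = false →
    ∀ e, d < e → (cyclicEdge a b e || (cyclicEdge a c e || (cyclicEdge b c e ||
      (cyclicEdge a d e || (cyclicEdge b d e || cyclicEdge c d e))))) = true := by
  decide +kernel

/-- The coloring of the triples of `Fin 13` in which the edges of the cyclic hypergraph get
color `0` and the other triples get color `1`. -/
def cyclicColoring (t : Finset (Fin 13)) : Fin 2 :=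
  bif cyclicMask.testBit (∑ v ∈ t, 2 ^ v.1) then 0 else 1

theorem cyclicColoring_eq {a b c : Fin 13} (hab : a ≠ b) (hac : a ≠ c) (hbc : b ≠ c) :
    cyclicColoring {a, b, c} = bif cyclicEdge a b c then 0 else 1 := by
  rw [cyclicColoring, Finset.sum_insert (by simp [hab, hac]), Finset.sum_pair hbc, cyclicEdge]

theorem cyclicColoring_eq_zero {a b c : Fin 13} (hab : a ≠ b) (hac : a ≠ c) (hbc : b ≠ c)
    (h : cyclicColoring {a, b, c} = 0) : cyclicEdge a b c = true := by
  rw [cyclicColoring_eq hab hac hbc] at h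
  cases h' : cyclicEdge a b c
  · simp [h'] at h
  · rfl

theorem cyclicColoring_eq_one {a b c : Fin 13} (hab : a ≠ b) (hac : a ≠ c) (hbc : b ≠ c)
    (h : cyclicColoring {a, b, c} = 1) : cyclicEdge a b c = false := by
  rw [cyclicColoring_eq hab hac hbc] at h
  cases h' : cyclicEdge a b c
  · rfl
  · simp [h'] at h

theorem not_hasK4minus_cyclicColoring : ¬ HasK4minus cyclicColoring 0 := by
  intro h
  obtain ⟨a, b, c, d, hab, hac, had, hbc, hbd, hcd, h₁, h₂, h₃⟩ := exists_of_hasK4minus h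
  have h := cyclicEdge_four a b hab c hbc (cyclicColoring_eq_zero hab hac hbc h₁) d hcd
    (cyclicColoring_eq_zero hab had hbd h₂)
  rw [cyclicColoring_eq_zero hac had hcd h₃] at h
  cases h

theorem not_hasK5_cyclicColoring : ¬ HasK5 cyclicColoring 1 := by
  rintro ⟨S, hS, h⟩
  have hlt : ∀ {i j : Fin 5}, i < j → S.orderEmbOfFin hS i < S.orderEmbOfFin hS j :=
    fun hij => (S.orderEmbOfFin hS).strictMono hij
  have hedge : ∀ {i j k : Fin 5}, i < j → j < k →
      cyclicEdge (S.orderEmbOfFin hS i) (S.orderEmbOfFin hS j) (S.orderEmbOfFin hS k) = false := by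
    intro i j k hij hjk
    have hab := (hlt hij).ne
    have hac := (hlt (hij.trans hjk)).ne
    have hbc := (hlt hjk).ne
    refine cyclicColoring_eq_one hab hac hbc (h _ (Finset.mem_powersetCard.2 ⟨?_, ?_⟩))
    · simp [Finset.insert_subset_iff]
    · exact Finset.card_eq_three.2 ⟨_, _, _, hab, hac, hbc, rfl⟩
  have h01 : (0 : Fin 5) < 1 := by decide
  have h12 : (1 : Fin 5) < 2 := by decide
  have h23 : (2 : Fin 5) < 3 := by decide
  have h34 : (3 : Fin 5) < 4 := by decide
  have h02 := h01.trans h12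
  have h13 := h12.trans h23
  have h24 := h23.trans h34
  have h14 := h12.trans h24
  have := cyclicEdge_five _ _ (hlt h01) _ (hlt h12) (hedge h01 h12) _ (hlt h23) (hedge h01 h13)
    (hedge h02 h23) (hedge h12 h23) _ (hlt h34)
  simp [hedge h01 h14, hedge h02 h24, hedge h12 h24, hedge (h02.trans h23) h34, hedge h13 h34,
    hedge h23 h34] at this

end LowerBound

theorem hasK4minus_or_hasK5 (c : Finset (Fin 16) → Fin 2) : HasK4minus c 0 ∨ HasK5 c 1 := by
  by_contra hc
  rw [not_or] at hc
  obtain ⟨hK4, hK5⟩ := hc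
  have hneg : ∀ S ∈ (Finset.univ : Finset (Fin 16)).powersetCard 6,
      tupleSum 6 S (density fun u v w => decide (c {u, v, w} = 0)) < 0 := by
    intro S hS
    refine tupleSum_density_neg (fun t => decide (c t = 0)) ?_ ?_ S (Finset.mem_powersetCard.1 hS).2
    · intro u v w x huv huw hux hvw hvx hwx h₁ h₂ h₃
      exact hK4 (hasK4minus_of_eq huv huw hux hvw hvx hwx (of_decide_eq_true h₁)
        (of_decide_eq_true h₂) (of_decide_eq_true h₃))
    · intro T hT
      by_contra! hno
      refine hK5 ⟨T, hT, fun t ht => ?_⟩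
      obtain ⟨htT, ht3⟩ := Finset.mem_powersetCard.1 ht
      have h := hno t htT ht3
      simp only [ne_eq, decide_eq_true_eq] at h
      omega
  have hne : ((Finset.univ : Finset (Fin 16)).powersetCard 6).Nonempty :=
    Finset.powersetCard_nonempty.2 (by simp)
  refine absurd (Finset.sum_lt_sum_of_nonempty hne hneg) (not_lt.2 ?_)
  rw [sum_powersetCard_tupleSum, Finset.sum_const_zero]
  exact tupleSum_density_nonneg _ (by simp) _

/-- `14 ≤ R(K₄⁻, K₅; 3) ≤ 16`. -/
theorem ramsey3_K4minus_K5_bounds :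
    (∃ c : Finset (Fin 13) → Fin 2, ¬ HasK4minus c 0 ∧ ¬ HasK5 c 1) ∧
    (∀ c : Finset (Fin 16) → Fin 2, HasK4minus c 0 ∨ HasK5 c 1) :=
  ⟨⟨cyclicColoring, not_hasK4minus_cyclicColoring, not_hasK5_cyclicColoring⟩, hasK4minus_or_hasK5⟩
end

section
/- R(K_{4,4}, K_{4,4}) ≤ 49. That is: for every coloring of the edges of the complete graph on 49 vertices with 2 colors, some color class contains a subgraph isomorphic to the complete bipartite graph K_{4,4}. -/
/-- The coloring `c` of the edges of the complete graph on `Fin n` with `k` colors contains a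
copy of `G` all of whose edges have color `i`. -/
def HasMonoCopy {V : Type} {n k : ℕ} (G : SimpleGraph V)
    (c : Sym2 (Fin n) → Fin k) (i : Fin k) : Prop :=
  ∃ f : V → Fin n, Function.Injective f ∧ ∀ u v : V, G.Adj u v → c s(f u, f v) = i

/-- The tangent line at `k` of the convex function `a ↦ a.choose 4`. -/
theorem mul_choose_three_le (a k : ℕ) :
    a * k.choose 3 ≤ a.choose 4 + 3 * (k + 1).choose 4 := by
  have tangent_at (k : ℕ) : k * k.choose 3 = k.choose 4 + 3 * (k + 1).choose 4 := by
    have h := Nat.choose_succ_right_eq k 3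
    have h' : (k + 1).choose 4 = k.choose 3 + k.choose 4 := Nat.choose_succ_succ k 3
    rcases le_or_gt 3 k with hk | hk
    · obtain ⟨j, rfl⟩ := Nat.exists_eq_add_of_le hk
      simp only [Nat.add_sub_cancel_left] at h
      nlinarith
    · interval_cases k <;> decide
  rcases le_total k a with hka | hak
  · induction a, hka using Nat.le_induction with
    | base => exact (tangent_at k).le
    | succ a hka ih =>
      have h : (a + 1).choose 4 = a.choose 3 + a.choose 4 := Nat.choose_succ_succ a 3
      have := Nat.choose_le_choose 3 hka
      nlinarith
  · induction k, hak using Nat.le_induction with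
    | base => exact (tangent_at a).le
    | succ k hak ih =>
      have h₁ : (k + 1).choose 3 = k.choose 2 + k.choose 3 := Nat.choose_succ_succ k 2
      have h₂ : (k + 2).choose 4 = (k + 1).choose 3 + (k + 1).choose 4 :=
        Nat.choose_succ_succ (k + 1) 3
      have h₃ : (k + 1) * k.choose 2 = (k + 1).choose 3 * 3 := Nat.add_one_mul_choose_eq k 2
      have := Nat.mul_le_mul_right (k.choose 2) (hak.trans k.le_succ)
      have h₄ : (k + 1 + 1).choose 4 = (k + 2).choose 4 := rfl
      nlinarith

theorem sum_choose_card_inter_le {V : Type*} [DecidableEq V] (W N : Finset V) (f : V → Finset V)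
    (r : ℕ) (h : ∀ S ⊆ N, S.card = r → (W.filter fun w ↦ S ⊆ f w).card ≤ 1) :
    ∑ w ∈ W, (N ∩ f w).card.choose r ≤ N.card.choose r := by
  calc ∑ w ∈ W, (N ∩ f w).card.choose r
      = ∑ w ∈ W, ((N.powersetCard r).filter fun S ↦ S ⊆ f w).card := by
        refine Finset.sum_congr rfl fun w _ ↦ ?_
        rw [← Finset.card_powersetCard]
        congr 1
        ext S
        simp only [Finset.mem_powersetCard, Finset.mem_filter, Finset.subset_inter_iff]
        tauto
    _ = ∑ S ∈ N.powersetCard r, (W.filter fun w ↦ S ⊆ f w).card :=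
        Finset.sum_card_bipartiteAbove_eq_sum_card_bipartiteBelow fun w S ↦ S ⊆ f w
    _ ≤ ∑ S ∈ N.powersetCard r, 1 := Finset.sum_le_sum fun S hS ↦ by
        rw [Finset.mem_powersetCard] at hS
        exact h S hS.1 hS.2
    _ = N.card.choose r := by simp

/-- No biclique with four vertices on each side. -/
def SimpleGraph.NoK44 {V : Type*} (G : SimpleGraph V) : Prop :=
  ∀ S T : Finset V, S.card = 4 → T.card = 4 → ¬ ∀ s ∈ S, ∀ t ∈ T, G.Adj s t

section NoK44

variable {V : Type*} [Fintype V] [DecidableEq V] {G : SimpleGraph V} [DecidableRel G.Adj]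

theorem SimpleGraph.NoK44.card_filter_le_one (hG : G.NoK44) {u v : V} (huv : u ≠ v)
    {S : Finset V} (hS : S ⊆ G.neighborFinset u ∩ G.neighborFinset v) (hc : S.card = 4) :
    (({u, v}ᶜ : Finset V).filter fun w ↦ S ⊆ G.neighborFinset w).card ≤ 1 := by
  by_contra! hlt
  obtain ⟨w, hw, x, hx, hwx⟩ := Finset.one_lt_card.1 hlt
  simp only [Finset.mem_filter, Finset.mem_compl, Finset.mem_insert, Finset.mem_singleton,
    not_or] at hw hx
  rw [Finset.subset_inter_iff] at hS
  refine hG {u, v, w, x} S ?_ hc fun s hs t ht ↦ ?_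
  · rw [Finset.card_insert_of_notMem, Finset.card_insert_of_notMem, Finset.card_pair hwx] <;>
      grind
  · simp only [Finset.mem_insert, Finset.mem_singleton] at hs
    rw [← SimpleGraph.mem_neighborFinset]
    rcases hs with rfl | rfl | rfl | rfl
    exacts [hS.1 ht, hS.2 ht, hw.2 ht, hx.2 ht]

theorem SimpleGraph.sum_degree_sub_two {u v : V} (huv : u ≠ v) :
    ∑ y ∈ G.neighborFinset u ∩ G.neighborFinset v, ((G.degree y : ℤ) - 2) =
      (∑ w ∈ ({u, v}ᶜ : Finset V),
        ((G.neighborFinset u ∩ G.neighborFinset v) ∩ G.neighborFinset w).card : ℕ) := by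
  set N := G.neighborFinset u ∩ G.neighborFinset v with hN
  have hdouble : ∑ w ∈ ({u, v}ᶜ : Finset V), (N ∩ G.neighborFinset w).card =
      ∑ y ∈ N, (({u, v}ᶜ : Finset V).filter fun w ↦ y ∈ G.neighborFinset w).card := by
    simp only [← Finset.filter_mem_eq_inter]
    exact Finset.sum_card_bipartiteAbove_eq_sum_card_bipartiteBelow
      fun w y ↦ y ∈ G.neighborFinset w
  rw [hdouble, Nat.cast_sum]
  refine Finset.sum_congr rfl fun y hy ↦ ?_
  rw [hN, Finset.mem_inter, mem_neighborFinset, mem_neighborFinset] at hy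
  have hsub : ({u, v} : Finset V) ⊆ G.neighborFinset y := by
    intro x
    simp only [Finset.mem_insert, Finset.mem_singleton, mem_neighborFinset]
    rintro (rfl | rfl)
    exacts [hy.1.symm, hy.2.symm]
  have hset : (({u, v}ᶜ : Finset V).filter fun w ↦ y ∈ G.neighborFinset w) =
      G.neighborFinset y \ {u, v} := by
    ext w
    simp only [Finset.mem_filter, Finset.mem_compl, Finset.mem_sdiff, mem_neighborFinset,
      G.adj_comm w y]
    tauto
  have := Finset.card_sdiff_add_card_eq_card hsub
  rw [Finset.card_pair huv, card_neighborFinset_eq_degree] at this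
  rw [hset]
  omega

theorem SimpleGraph.NoK44.choose_three_mul_sum_le (hG : G.NoK44) {u v : V} (huv : u ≠ v) (k : ℕ) :
    (k.choose 3 : ℤ) * ∑ y ∈ G.neighborFinset u ∩ G.neighborFinset v, ((G.degree y : ℤ) - 2) ≤
      ((G.neighborFinset u ∩ G.neighborFinset v).card.choose 4 : ℕ) +
        ((Fintype.card V : ℤ) - 2) * (3 * (k + 1).choose 4 : ℕ) := by
  rw [sum_degree_sub_two huv]
  set N := G.neighborFinset u ∩ G.neighborFinset v
  have hW : ((({u, v}ᶜ : Finset V).card : ℕ) : ℤ) = (Fintype.card V : ℤ) - 2 := by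
    have := Finset.card_add_card_compl ({u, v} : Finset V)
    rw [Finset.card_pair huv] at this
    omega
  have hquad := sum_choose_card_inter_le ({u, v}ᶜ : Finset V) N (fun w ↦ G.neighborFinset w) 4
    fun S hS hc ↦ hG.card_filter_le_one huv hS hc
  have htan := Finset.sum_le_sum fun w (_ : w ∈ ({u, v}ᶜ : Finset V)) ↦
    mul_choose_three_le (N ∩ G.neighborFinset w).card k
  rw [← Finset.sum_mul, Finset.sum_add_distrib, Finset.sum_const, smul_eq_mul] at htan
  rw [← hW, mul_comm]
  exact_mod_cast htan.trans (Nat.add_le_add_right hquad _)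

end NoK44

/-- In a graph on 49 vertices without `K_{4,4}`, an upper bound for `15 * p - 86` times the sum of
`d y - 2` over the common neighbours `y` of two vertices of codegree `p`. -/
def weightBound (p : ℕ) : ℤ :=
  let k := (2 * p + 4) / 5
  if p < 6 then 0
  else (15 * p - 86) *
    ((p.descFactorial 4 / 24 + 141 * ((k + 1).descFactorial 4 / 24)) / (k.descFactorial 3 / 6) : ℕ)

theorem SimpleGraph.NoK44.weighted_sum_le {V : Type*} [Fintype V] [DecidableEq V]
    {G : SimpleGraph V} [DecidableRel G.Adj] (hG : G.NoK44) (hV : Fintype.card V = 49)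
    {u v : V} (huv : u ≠ v) :
    (15 * ((G.neighborFinset u ∩ G.neighborFinset v).card : ℤ) - 86) *
        ∑ y ∈ G.neighborFinset u ∩ G.neighborFinset v, ((G.degree y : ℤ) - 2) ≤
      weightBound (G.neighborFinset u ∩ G.neighborFinset v).card := by
  have hlocal := hG.choose_three_mul_sum_le huv
    ((2 * (G.neighborFinset u ∩ G.neighborFinset v).card + 4) / 5)
  have hnonneg : 0 ≤ ∑ y ∈ G.neighborFinset u ∩ G.neighborFinset v, ((G.degree y : ℤ) - 2) := by
    rw [sum_degree_sub_two huv]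
    positivity
  generalize ∑ y ∈ G.neighborFinset u ∩ G.neighborFinset v, ((G.degree y : ℤ) - 2) = s at *
  generalize (G.neighborFinset u ∩ G.neighborFinset v).card = p at *
  rw [weightBound]
  split_ifs with hp
  · exact mul_nonpos_of_nonpos_of_nonneg (by lia) hnonneg
  · have hk : 3 ≤ (2 * p + 4) / 5 := by lia
    have hpos : 0 < ((2 * p + 4) / 5).choose 3 := Nat.choose_pos hk
    refine mul_le_mul_of_nonneg_left ?_ (by lia)
    rw [show 24 = Nat.factorial 4 from rfl, show 6 = Nat.factorial 3 from rfl,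
      ← Nat.choose_eq_descFactorial_div_factorial, ← Nat.choose_eq_descFactorial_div_factorial,
      ← Nat.choose_eq_descFactorial_div_factorial, Int.natCast_ediv]
    refine Int.le_ediv_of_mul_le (by exact_mod_cast hpos) ?_
    rw [hV] at hlocal
    push_cast at hlocal ⊢
    linarith

theorem weightBound_add_lt : ∀ p < 50, ∀ m < 50,
    2 * weightBound p + 2 * weightBound m + 3796 * (p + m) + 146 * (p - m + 1 : ℤ) ^ 2 <
      15 * ((44 + (p - m + 1)) * ((p : ℤ) ^ 2 - p) + (44 - (p - m + 1)) * ((m : ℤ) ^ 2 - m)) +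
        424 * (p - m + 1) + 15456 := by
  decide +kernel

section RowInner

variable {V : Type*} [Fintype V] (a : V → V → ℤ)

/-- The row sums of `a`: degrees, if `a` is an adjacency matrix. -/
def rowSum (u : V) : ℤ := ∑ v, a u v

/-- The inner products of the rows of `a`: codegrees, if `a` is an adjacency matrix. -/
def rowInner (u v : V) : ℤ := ∑ y, a u y * a v y

/-- The inner products of the rows of `a`, with column `y` weighted by `rowSum a y - 2`. -/
def wInner (u v : V) : ℤ := ∑ y, a u y * a v y * (rowSum a y - 2)

variable {a}

theorem sum_rowInner_mul (hs : ∀ u v, a u v = a v u) (g : V → ℤ) :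
    ∑ u, ∑ v, ∑ y, a u y * a v y * g y = ∑ y, rowSum a y ^ 2 * g y := by
  have h (u : V) : ∑ v, ∑ y, a u y * a v y * g y = ∑ y, ∑ v, a u y * a v y * g y :=
    Finset.sum_comm
  simp only [h]
  rw [Finset.sum_comm]
  refine Finset.sum_congr rfl fun y _ ↦ ?_
  simp only [rowSum, sq, Finset.sum_mul, Finset.mul_sum, hs y]
  exact Finset.sum_comm

theorem sum_diag_mul (hs : ∀ u v, a u v = a v u) (hi : ∀ u v, a u v * a u v = a u v) (g h : V → ℤ) :
    ∑ u, (h u * ∑ y, a u y * a u y * g y) = ∑ y, g y * ∑ u, a y u * h u := by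
  simp only [hi, Finset.mul_sum]
  rw [Finset.sum_comm]
  refine Finset.sum_congr rfl fun y _ ↦ Finset.sum_congr rfl fun u _ ↦ ?_
  rw [hs u y]; ring

theorem sum_rowInner_mul_wInner (hs : ∀ u v, a u v = a v u) (g : V → ℤ) :
    ∑ u, ∑ v, rowInner a u v * (∑ y, a u y * a v y * g y) =
      ∑ y, ∑ z, g y * rowInner a y z ^ 2 := by
  have h1 (u v : V) : rowInner a u v * (∑ y, a u y * a v y * g y) =
      ∑ y, ∑ z, g y * ((a y u * a z u) * (a y v * a z v)) := by
    rw [rowInner, mul_comm, Finset.sum_mul_sum]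
    refine Finset.sum_congr rfl fun y _ ↦ Finset.sum_congr rfl fun z _ ↦ ?_
    rw [hs u y, hs u z, hs v y, hs v z]; ring
  have h2 (y z : V) : g y * rowInner a y z ^ 2 =
      ∑ u, ∑ v, g y * ((a y u * a z u) * (a y v * a z v)) := by
    rw [rowInner, sq, Finset.sum_mul_sum]
    simp only [Finset.mul_sum]
  simp only [h1, h2]
  rw [Finset.sum_congr rfl fun u _ ↦ (Finset.sum_comm : ∑ v, ∑ y, _ = _), Finset.sum_comm]
  refine Finset.sum_congr rfl fun y _ ↦ ?_
  rw [Finset.sum_congr rfl fun u _ ↦ (Finset.sum_comm : ∑ v, ∑ z, _ = _), Finset.sum_comm]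

theorem sum_erase_eq [DecidableEq V] (f : V → V → ℤ) :
    ∑ u, ∑ v ∈ Finset.univ.erase u, f u v = ∑ u, ∑ v, f u v - ∑ u, f u u := by
  rw [← Finset.sum_sub_distrib]
  exact Finset.sum_congr rfl fun u _ ↦ Finset.sum_erase_eq_sub (Finset.mem_univ u)

theorem sum_erase_add [DecidableEq V] (f g : V → V → ℤ) :
    ∑ u, ∑ v ∈ Finset.univ.erase u, (f u v + g u v) =
      ∑ u, ∑ v ∈ Finset.univ.erase u, f u v + ∑ u, ∑ v ∈ Finset.univ.erase u, g u v := by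
  simp only [Finset.sum_add_distrib]

theorem rowInner_comm (u v : V) : rowInner a u v = rowInner a v u := by
  simp only [rowInner, mul_comm]

theorem rowInner_self (hi : ∀ u v, a u v * a u v = a u v) (u : V) :
    rowInner a u u = rowSum a u := by
  simp only [rowInner, rowSum, hi]

theorem sum_off_rowInner [DecidableEq V] (hs : ∀ u v, a u v = a v u)
    (hi : ∀ u v, a u v * a u v = a u v) :
    ∑ u, ∑ v ∈ Finset.univ.erase u, rowInner a u v = ∑ y, (rowSum a y ^ 2 - rowSum a y) := by
  rw [sum_erase_eq, Finset.sum_sub_distrib]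
  have h := sum_rowInner_mul hs fun _ ↦ 1
  simp only [mul_one] at h
  simp only [rowInner_self hi]
  rw [← h]
  rfl

theorem sum_off_wInner [DecidableEq V] (hs : ∀ u v, a u v = a v u)
    (hi : ∀ u v, a u v * a u v = a u v) :
    ∑ u, ∑ v ∈ Finset.univ.erase u, wInner a u v =
      ∑ y, (rowSum a y - 2) * (rowSum a y ^ 2 - rowSum a y) := by
  have h := sum_diag_mul hs hi (fun y ↦ rowSum a y - 2) fun _ ↦ 1
  simp only [one_mul, mul_one] at h
  rw [sum_erase_eq]
  simp only [wInner]
  rw [sum_rowInner_mul hs, h, ← Finset.sum_sub_distrib]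
  refine Finset.sum_congr rfl fun y _ ↦ ?_
  rw [← rowSum]; ring

theorem sum_off_rowInner_mul_wInner [DecidableEq V] (hs : ∀ u v, a u v = a v u)
    (hi : ∀ u v, a u v * a u v = a u v) :
    2 * ∑ u, ∑ v ∈ Finset.univ.erase u, rowInner a u v * wInner a u v =
      ∑ u, ∑ v ∈ Finset.univ.erase u,
        (rowSum a u + rowSum a v - 4) * (rowInner a u v ^ 2 - rowInner a u v) +
      2 * ∑ y, (rowSum a y - 2) * (rowSum a y ^ 2 - rowSum a y) := by
  have hdiag : ∑ u, rowInner a u u * wInner a u u =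
      ∑ u, ∑ v, (rowSum a u - 2) * rowInner a u v := by
    simp only [wInner, sum_diag_mul hs hi, ← Finset.mul_sum]
    refine Finset.sum_congr rfl fun y _ ↦ ?_
    congr 1
    simp only [rowInner_self hi]
    simp only [rowInner]
    rw [Finset.sum_comm]
    refine Finset.sum_congr rfl fun u _ ↦ ?_
    simp only [rowSum, Finset.mul_sum, hs u]
  have hoff : ∑ u, ∑ v ∈ Finset.univ.erase u, rowInner a u v * wInner a u v =
      ∑ u, ∑ v, (rowSum a u - 2) * (rowInner a u v ^ 2 - rowInner a u v) := by
    rw [sum_erase_eq, hdiag]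
    simp only [wInner]
    rw [sum_rowInner_mul_wInner hs]
    simp only [mul_sub, Finset.sum_sub_distrib]
  have hswap : ∑ u, ∑ v, (rowSum a v - 2) * (rowInner a u v ^ 2 - rowInner a u v) =
      ∑ u, ∑ v, (rowSum a u - 2) * (rowInner a u v ^ 2 - rowInner a u v) := by
    rw [Finset.sum_comm]
    simp only [rowInner_comm]
  have hsplit : ∑ u, ∑ v, (rowSum a u + rowSum a v - 4) * (rowInner a u v ^ 2 - rowInner a u v) =
      ∑ u, ∑ v, (rowSum a u - 2) * (rowInner a u v ^ 2 - rowInner a u v) +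
      ∑ u, ∑ v, (rowSum a v - 2) * (rowInner a u v ^ 2 - rowInner a u v) := by
    simp only [← Finset.sum_add_distrib]
    refine Finset.sum_congr rfl fun u _ ↦ Finset.sum_congr rfl fun v _ ↦ ?_
    ring
  have hself : ∑ u, (rowSum a u + rowSum a u - 4) * (rowInner a u u ^ 2 - rowInner a u u) =
      2 * ∑ y, (rowSum a y - 2) * (rowSum a y ^ 2 - rowSum a y) := by
    rw [Finset.mul_sum]
    refine Finset.sum_congr rfl fun u _ ↦ ?_
    rw [rowInner_self hi]; ring
  rw [hoff, sum_erase_eq, hsplit, hswap, hself]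
  ring

theorem sum_off_combined [DecidableEq V] (hs : ∀ u v, a u v = a v u)
    (hi : ∀ u v, a u v * a u v = a u v) (α β γ : ℤ) :
    ∑ u, ∑ v ∈ Finset.univ.erase u, (2 * ((α * rowInner a u v - β) * wInner a u v) -
        α * ((rowSum a u + rowSum a v - 4) * (rowInner a u v ^ 2 - rowInner a u v)) +
        γ * rowInner a u v) =
      ∑ y, (2 * (α - β) * (rowSum a y - 2) + γ) * (rowSum a y ^ 2 - rowSum a y) := by
  have h₁ := sum_off_rowInner hs hi
  have h₂ := sum_off_wInner hs hi
  have h₃ := sum_off_rowInner_mul_wInner hs hi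
  have hl : ∑ u, ∑ v ∈ Finset.univ.erase u, (2 * ((α * rowInner a u v - β) * wInner a u v) -
        α * ((rowSum a u + rowSum a v - 4) * (rowInner a u v ^ 2 - rowInner a u v)) +
        γ * rowInner a u v) =
      α * (2 * ∑ u, ∑ v ∈ Finset.univ.erase u, rowInner a u v * wInner a u v) -
      2 * β * ∑ u, ∑ v ∈ Finset.univ.erase u, wInner a u v -
      α * ∑ u, ∑ v ∈ Finset.univ.erase u,
        (rowSum a u + rowSum a v - 4) * (rowInner a u v ^ 2 - rowInner a u v) +
      γ * ∑ u, ∑ v ∈ Finset.univ.erase u, rowInner a u v := by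
    simp only [Finset.mul_sum, ← Finset.sum_add_distrib, ← Finset.sum_sub_distrib]
    refine Finset.sum_congr rfl fun u _ ↦ Finset.sum_congr rfl fun v _ ↦ ?_
    ring
  have hr : ∑ y, (2 * (α - β) * (rowSum a y - 2) + γ) * (rowSum a y ^ 2 - rowSum a y) =
      2 * (α - β) * ∑ y, (rowSum a y - 2) * (rowSum a y ^ 2 - rowSum a y) +
      γ * ∑ y, (rowSum a y ^ 2 - rowSum a y) := by
    simp only [Finset.mul_sum, ← Finset.sum_add_distrib]
    refine Finset.sum_congr rfl fun u _ ↦ ?_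
    ring
  rw [hl, hr, h₁, h₂, h₃]
  ring

theorem sum_off_sign [DecidableEq V] (hs : ∀ u v, a u v = a v u) (h0 : ∀ u, a u u = 0)
    (g : V → ℤ) :
    ∑ u, ∑ v ∈ Finset.univ.erase u, (2 * a u v - 1) * (g u + g v) =
      ∑ u, (4 * rowSum a u - 2 * (Fintype.card V - 1)) * g u := by
  have h₁ : ∑ u, ∑ v, a u v * g u = ∑ u, rowSum a u * g u := by
    simp only [rowSum, Finset.sum_mul]
  have h₂ : ∑ u, ∑ v, a u v * g v = ∑ u, rowSum a u * g u := by
    rw [← h₁, Finset.sum_comm]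
    simp only [hs]
  have h₃ (u v : V) : (2 * a u v - 1) * (g u + g v) =
      2 * (a u v * g u) + 2 * (a u v * g v) - g u - g v := by ring
  have h₄ (u : V) : (4 * rowSum a u - 2 * (Fintype.card V - 1)) * g u =
      4 * (rowSum a u * g u) - 2 * Fintype.card V * g u + 2 * g u := by ring
  rw [sum_erase_eq]
  simp only [h₃, h₄, h0, Finset.sum_add_distrib, Finset.sum_sub_distrib, ← Finset.mul_sum, h₁, h₂,
    Finset.sum_const, Finset.card_univ, nsmul_eq_mul]
  ring

theorem sum_off_add_sq [DecidableEq V] (g : V → ℤ) :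
    ∑ u, ∑ v ∈ Finset.univ.erase u, (g u + g v) ^ 2 =
      2 * (Fintype.card V - 2) * ∑ u, g u ^ 2 + 2 * (∑ u, g u) ^ 2 := by
  have h (u v : V) : (g u + g v) ^ 2 = g u ^ 2 + 2 * (g u * g v) + g v ^ 2 := by ring
  rw [sum_erase_eq, sq (∑ u, g u), Finset.sum_mul_sum]
  simp only [h, Finset.sum_add_distrib, ← Finset.mul_sum, Finset.sum_const, Finset.card_univ,
    nsmul_eq_mul, ← sq]
  ring

end RowInner

namespace SimpleGraph

section AdjMatrix

variable {V : Type*} (G : SimpleGraph V) [DecidableRel G.Adj]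

theorem adjMatrix_symm_apply (u v : V) : G.adjMatrix ℤ u v = G.adjMatrix ℤ v u := by
  simp only [adjMatrix_apply, G.adj_comm]

theorem adjMatrix_mul_self_apply (u v : V) :
    G.adjMatrix ℤ u v * G.adjMatrix ℤ u v = G.adjMatrix ℤ u v := by
  simp [adjMatrix_apply]

theorem adjMatrix_compl_eq [DecidableEq V] (u v : V) :
    Gᶜ.adjMatrix ℤ u v = 1 - (if u = v then 1 else 0) - G.adjMatrix ℤ u v := by
  by_cases huv : u = v
  · simp [huv]
  · by_cases h : G.Adj u v <;> simp [adjMatrix_apply, huv, h]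

theorem rowSum_adjMatrix [Fintype V] (u : V) : rowSum (G.adjMatrix ℤ) u = G.degree u := by
  simp [rowSum, adjMatrix_apply, ← card_neighborFinset_eq_degree, neighborFinset_eq_filter]

end AdjMatrix

variable {V : Type*} [Fintype V] [DecidableEq V] (G : SimpleGraph V) [DecidableRel G.Adj]

theorem sum_adjMatrix_mul_mul (f : V → ℤ) (u v : V) :
    ∑ y, G.adjMatrix ℤ u y * G.adjMatrix ℤ v y * f y =
      ∑ y ∈ G.neighborFinset u ∩ G.neighborFinset v, f y := by
  have h (y : V) : G.adjMatrix ℤ u y * G.adjMatrix ℤ v y * f y =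
      if y ∈ G.neighborFinset u ∩ G.neighborFinset v then f y else 0 := by
    by_cases h₁ : G.Adj u y <;> by_cases h₂ : G.Adj v y <;> simp [adjMatrix_apply, h₁, h₂]
  simp only [h, Finset.sum_ite_mem, Finset.univ_inter]

theorem rowInner_adjMatrix (u v : V) :
    rowInner (G.adjMatrix ℤ) u v = (G.neighborFinset u ∩ G.neighborFinset v).card := by
  simpa [rowInner] using G.sum_adjMatrix_mul_mul (fun _ ↦ 1) u v

theorem wInner_adjMatrix (u v : V) :
    wInner (G.adjMatrix ℤ) u v =
      ∑ y ∈ G.neighborFinset u ∩ G.neighborFinset v, ((G.degree y : ℤ) - 2) := by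
  simp only [wInner, rowSum_adjMatrix, sum_adjMatrix_mul_mul]

theorem rowSum_adjMatrix_compl (u : V) :
    rowSum (Gᶜ.adjMatrix ℤ) u = Fintype.card V - 1 - rowSum (G.adjMatrix ℤ) u := by
  simp only [rowSum, adjMatrix_compl_eq, Finset.sum_sub_distrib, Finset.sum_ite_eq,
    Finset.mem_univ, if_true, Finset.sum_const, Finset.card_univ, nsmul_eq_mul, mul_one]

theorem rowInner_adjMatrix_compl {u v : V} (huv : u ≠ v) :
    rowInner (Gᶜ.adjMatrix ℤ) u v = Fintype.card V - 2 - rowSum (G.adjMatrix ℤ) u -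
      rowSum (G.adjMatrix ℤ) v + 2 * G.adjMatrix ℤ u v + rowInner (G.adjMatrix ℤ) u v := by
  have h (y : V) : Gᶜ.adjMatrix ℤ u y * Gᶜ.adjMatrix ℤ v y =
      1 - G.adjMatrix ℤ u y - G.adjMatrix ℤ v y + G.adjMatrix ℤ u y * G.adjMatrix ℤ v y -
        (if u = y then 1 - G.adjMatrix ℤ v y else 0) -
        (if v = y then 1 - G.adjMatrix ℤ u y else 0) := by
    rw [adjMatrix_compl_eq, adjMatrix_compl_eq]
    split_ifs with h₁ h₂ <;> first | exact absurd (h₁.trans h₂.symm) huv | ring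
  simp only [rowInner, h, Finset.sum_add_distrib, Finset.sum_sub_distrib, Finset.sum_ite_eq,
    Finset.mem_univ, if_true, Finset.sum_const, Finset.card_univ, nsmul_eq_mul, rowSum,
    G.adjMatrix_symm_apply v u]
  ring

/-- The estimate for a pair of vertices whose sum over all pairs is contradictory. -/
theorem NoK44.pair_lt {G : SimpleGraph V} [DecidableRel G.Adj] (hG : G.NoK44) (hG' : Gᶜ.NoK44)
    (hV : Fintype.card V = 49) {u v : V} (huv : u ≠ v) {a b : V → V → ℤ} {g : V → ℤ}
    (ha : a = G.adjMatrix ℤ) (hb : b = Gᶜ.adjMatrix ℤ) (hg : ∀ u, g u = rowSum a u - 24) :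
    (2 * ((15 * rowInner a u v - 86) * wInner a u v) -
        15 * ((rowSum a u + rowSum a v - 4) * (rowInner a u v ^ 2 - rowInner a u v)) +
        3796 * rowInner a u v) +
      (2 * ((15 * rowInner b u v - 86) * wInner b u v) -
        15 * ((rowSum b u + rowSum b v - 4) * (rowInner b u v ^ 2 - rowInner b u v)) +
        3796 * rowInner b u v) <
      424 * ((2 * a u v - 1) * (g u + g v)) - 146 * (g u + g v) ^ 2 + 15456 := by
  have hp := hG.weighted_sum_le hV huv
  have hm := hG'.weighted_sum_le hV huv
  rw [← wInner_adjMatrix, ← ha] at hp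
  rw [← wInner_adjMatrix, ← hb] at hm
  have hpc := G.rowInner_adjMatrix u v
  have hmc := Gᶜ.rowInner_adjMatrix u v
  have hrel := G.rowInner_adjMatrix_compl huv
  have hdu := G.rowSum_adjMatrix_compl u
  have hdv := G.rowSum_adjMatrix_compl v
  rw [← ha, ← hb, hV] at hrel hdu hdv
  rw [← ha] at hpc
  rw [← hb] at hmc
  have hp50 : (G.neighborFinset u ∩ G.neighborFinset v).card < 50 :=
    (Finset.card_le_univ _).trans_lt (by rw [hV]; norm_num)
  have hm50 : (Gᶜ.neighborFinset u ∩ Gᶜ.neighborFinset v).card < 50 :=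
    (Finset.card_le_univ _).trans_lt (by rw [hV]; norm_num)
  have h₁ := weightBound_add_lt _ hp50 _ hm50
  have h₂ := weightBound_add_lt _ hm50 _ hp50
  rw [hpc, hmc] at hrel ⊢
  generalize (G.neighborFinset u ∩ G.neighborFinset v).card = p at *
  generalize (Gᶜ.neighborFinset u ∩ Gᶜ.neighborFinset v).card = m at *
  generalize wInner a u v = s at *
  generalize wInner b u v = t at *
  rw [hg, hg, hdu, hdv]
  push_cast at hrel ⊢
  generalize rowSum a u = x at *
  obtain ha01 | ha01 : a u v = 1 ∨ a u v = 0 := by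
    rw [ha, adjMatrix_apply]
    split_ifs <;> simp
  · rw [ha01] at hrel ⊢
    obtain rfl : x = 49 + p - m - rowSum a v := by linarith
    linarith
  · rw [ha01] at hrel ⊢
    obtain rfl : x = 47 + p - m - rowSum a v := by linarith
    linarith

theorem NoK44.not_compl {G : SimpleGraph V} [DecidableRel G.Adj] (hG : G.NoK44)
    (hV : Fintype.card V = 49) : ¬ Gᶜ.NoK44 := by
  intro hG'
  obtain ⟨a, ha⟩ : ∃ a : V → V → ℤ, a = G.adjMatrix ℤ := ⟨_, rfl⟩
  obtain ⟨b, hb⟩ : ∃ b : V → V → ℤ, b = Gᶜ.adjMatrix ℤ := ⟨_, rfl⟩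
  obtain ⟨g, hg⟩ : ∃ g : V → ℤ, ∀ u, g u = rowSum a u - 24 := ⟨_, fun _ ↦ rfl⟩
  have hne : (Finset.univ : Finset V).Nonempty := by
    rw [← Finset.card_pos, Finset.card_univ, hV]; norm_num
  have hlt := Finset.sum_lt_sum_of_nonempty hne fun u _ ↦
    Finset.sum_lt_sum_of_nonempty (s := Finset.univ.erase u)
      (by rw [← Finset.card_pos, Finset.card_erase_of_mem (Finset.mem_univ u), Finset.card_univ,
        hV]; norm_num)
      fun v hv ↦ hG.pair_lt hG' hV (Finset.ne_of_mem_erase hv).symm ha hb hg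
  have hA := sum_off_combined (a := a) (fun u v ↦ by rw [ha]; exact G.adjMatrix_symm_apply u v)
    (fun u v ↦ by rw [ha]; exact G.adjMatrix_mul_self_apply u v) 15 86 3796
  have hB := sum_off_combined (a := b) (fun u v ↦ by rw [hb]; exact Gᶜ.adjMatrix_symm_apply u v)
    (fun u v ↦ by rw [hb]; exact Gᶜ.adjMatrix_mul_self_apply u v) 15 86 3796
  have hsign := sum_off_sign (a := a) (fun u v ↦ by rw [ha]; exact G.adjMatrix_symm_apply u v)
    (fun u ↦ by rw [ha]; simp) g
  have hsq := sum_off_add_sq g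
  have hconst : ∑ u : V, ∑ _v ∈ Finset.univ.erase u, (15456 : ℤ) = 49 * 48 * 15456 := by
    simp [Finset.card_erase_of_mem, hV]
  have hd (u : V) : rowSum a u = g u + 24 := by rw [hg]; ring
  have hd' (u : V) : rowSum b u = 24 - g u := by
    rw [hg, ha, hb, rowSum_adjMatrix_compl, hV]; push_cast; ring
  have hright : ∑ u, ∑ v ∈ Finset.univ.erase u,
      (424 * ((2 * a u v - 1) * (g u + g v)) - 146 * (g u + g v) ^ 2 + 15456) =
      424 * ∑ u, ∑ v ∈ Finset.univ.erase u, (2 * a u v - 1) * (g u + g v) -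
      146 * ∑ u, ∑ v ∈ Finset.univ.erase u, (g u + g v) ^ 2 +
      ∑ u : V, ∑ _v ∈ Finset.univ.erase u, 15456 := by
    simp only [Finset.mul_sum, ← Finset.sum_add_distrib, ← Finset.sum_sub_distrib]
  have hsign' : ∑ u, (4 * rowSum a u - 2 * (Fintype.card V - 1)) * g u = 4 * ∑ u, g u ^ 2 := by
    rw [Finset.mul_sum]
    refine Finset.sum_congr rfl fun u _ ↦ ?_
    rw [hd, hV]; push_cast; ring
  have hleft : ∑ y, (2 * (15 - 86) * (rowSum a y - 2) + 3796) * (rowSum a y ^ 2 - rowSum a y) +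
      ∑ y, (2 * (15 - 86) * (rowSum b y - 2) + 3796) * (rowSum b y ^ 2 - rowSum b y) =
      49 * 741888 - 12004 * ∑ u, g u ^ 2 := by
    have hcard : ∑ _u : V, (741888 : ℤ) = 49 * 741888 := by simp [hV]
    rw [← hcard, Finset.mul_sum, ← Finset.sum_add_distrib, ← Finset.sum_sub_distrib]
    refine Finset.sum_congr rfl fun u _ ↦ ?_
    rw [hd, hd']; ring
  rw [sum_erase_add, hA, hB, hleft, hright, hsign, hsign', hsq, hconst, hV] at hlt
  have hX : 0 ≤ ∑ u, g u ^ 2 := Finset.sum_nonneg fun u _ ↦ sq_nonneg (g u)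
  have hY := sq_nonneg (∑ u, g u)
  push_cast at hlt
  linarith

end SimpleGraph

/-- `R(K_{4,4}, K_{4,4}) ≤ 49`. -/
theorem ramsey_K44_K44_le :
    ∀ c : Sym2 (Fin 49) → Fin 2,
      ∃ i : Fin 2, HasMonoCopy (completeBipartiteGraph (Fin 4) (Fin 4)) c i := by
  intro c
  by_contra! hc
  have key (G : SimpleGraph (Fin 49)) (i : Fin 2) (hGi : ∀ u v, G.Adj u v → c s(u, v) = i) :
      G.NoK44 := by
    intro S T hS hT hST
    let e := S.equivFinOfCardEq hS
    let e' := T.equivFinOfCardEq hT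
    refine hc i ⟨Sum.elim (fun j ↦ e.symm j) (fun j ↦ e'.symm j), ?_, ?_⟩
    · refine Function.Injective.sumElim (Subtype.val_injective.comp e.symm.injective)
        (Subtype.val_injective.comp e'.symm.injective) fun j k ↦ ?_
      exact (hST _ (e.symm j).2 _ (e'.symm k).2).ne
    · rintro (j | j) (k | k) h
      · simp at h
      · exact hGi _ _ (hST _ (e.symm j).2 _ (e'.symm k).2)
      · exact hGi _ _ (hST _ (e.symm k).2 _ (e'.symm j).2).symm
      · simp at h
  let G : SimpleGraph (Fin 49) :=
    { Adj := fun u v ↦ u ≠ v ∧ c s(u, v) = 0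
      symm := ⟨fun u v h ↦ ⟨h.1.symm, by rw [Sym2.eq_swap]; exact h.2⟩⟩
      loopless := ⟨fun u h ↦ h.1 rfl⟩ }
  have : DecidableRel G.Adj := fun u v ↦ inferInstanceAs (Decidable (u ≠ v ∧ c s(u, v) = 0))
  refine (key G 0 fun u v h ↦ h.2).not_compl (by simp) (key Gᶜ 1 fun u v h ↦ ?_)
  have h0 : c s(u, v) ≠ 0 := fun h0 ↦ h.2 ⟨h.1, h0⟩
  lia
end
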